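/- Fix a real p > 2. There exists β₀ = β₀(p) such that for every β ≥ β₀ there exist constants c₁, c₂, c₃ > 0 with the following property: for every integer h ≥ 1 there exists L₀ = L₀(β,h) such that for all integers L ≥ L₀, (i) e^{−c₁·β·h²} ≤ π^{(p)}_{B_L}(η_0 = h) ≤ e^{−c₂·β·h²}, and (ii) π^{(p)}_{B_L}(η_0 = h) ≤ e^{−c₃·β·h} · π^{(p)}_{B_L}(η_0 = h−1). -/

import Mathlib

open Filter Topology Classical

noncomputable section

abbrev Site : Type := ℤ × ℤ

/-- Nearest-neighbor adjacency in `ℤ²`. -/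
def adjP (x y : Site) : Prop := |x.1 - y.1| + |x.2 - y.2| = 1

/-- The `p`-SOS Hamiltonian `∑_{x∼y} |η_x − η_y|^p` (each ordered pair counted once,
whence the factor 1/2). -/
def pH (p : ℝ) (η : Site → ℤ) : ℝ :=
  (1 / 2) * ∑' pr : Site × Site,
    if adjP pr.1 pr.2 then ((|η pr.1 - η pr.2| : ℤ) : ℝ) ^ p else 0

/-- Unnormalized weight of the event `A` for the `p`-SOS model on `Λ` with zero
boundary conditions. -/
def pW (p β : ℝ) (Λ : Finset Site) (A : (Site → ℤ) → Prop) : ℝ :=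
  ∑' η : Site → ℤ, if (∀ x ∉ Λ, η x = 0) ∧ A η then Real.exp (-β * pH p η) else 0

/-- `π^{(p)}_Λ(A)`: probability of the event `A` under the `p`-SOS measure on `Λ`. -/
def pProb (p β : ℝ) (Λ : Finset Site) (A : (Site → ℤ) → Prop) : ℝ :=
  pW p β Λ A / pW p β Λ (fun _ => True)

/-- The lattice ball `B_r = {x ∈ ℤ² : |x| ≤ r}`. -/
def ball (r : ℝ) : Finset Site :=
  ((Finset.Icc (-⌈r⌉) ⌈r⌉) ×ˢ (Finset.Icc (-⌈r⌉) ⌈r⌉)).filter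
    fun x => ((x.1 : ℝ) ^ 2 + (x.2 : ℝ) ^ 2 ≤ r ^ 2)

def nbrs (x : Site) : Finset Site :=
  {(x.1+1,x.2),(x.1,x.2+1),(x.1-1,x.2),(x.1,x.2-1)}

lemma adjP_cases {x y : Site} (h : adjP x y) :
    (y.1 = x.1 + 1 ∧ y.2 = x.2) ∨ (y.1 = x.1 ∧ y.2 = x.2 + 1) ∨
    (y.1 = x.1 - 1 ∧ y.2 = x.2) ∨ (y.1 = x.1 ∧ y.2 = x.2 - 1) := by
  unfold adjP at h
  rcases abs_cases (x.1 - y.1) with h1 | h1 <;> rcases abs_cases (x.2 - y.2) with h2 | h2 <;> omega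

lemma adjP_of_cases {x y : Site} (h : (y.1 = x.1 + 1 ∧ y.2 = x.2) ∨ (y.1 = x.1 ∧ y.2 = x.2 + 1) ∨
    (y.1 = x.1 - 1 ∧ y.2 = x.2) ∨ (y.1 = x.1 ∧ y.2 = x.2 - 1)) : adjP x y := by
  unfold adjP
  rcases abs_cases (x.1 - y.1) with h1 | h1 <;> rcases abs_cases (x.2 - y.2) with h2 | h2 <;> omega

lemma adjP_comm {x y : Site} : adjP x y ↔ adjP y x := by
  unfold adjP; rw [abs_sub_comm, abs_sub_comm x.2]

lemma adjP_iff {x y : Site} : adjP x y ↔ y ∈ nbrs x := by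
  have : y ∈ nbrs x ↔ ((y.1 = x.1 + 1 ∧ y.2 = x.2) ∨ (y.1 = x.1 ∧ y.2 = x.2 + 1) ∨
    (y.1 = x.1 - 1 ∧ y.2 = x.2) ∨ (y.1 = x.1 ∧ y.2 = x.2 - 1)) := by
    simp [nbrs, Prod.ext_iff]
  rw [this]
  exact ⟨adjP_cases, adjP_of_cases⟩

def bdry (U : Finset Site) : Finset (Site × Site) :=
  (U.biUnion fun x => (nbrs x).image (fun y => (x, y))).filter (fun e => e.2 ∉ U)

lemma mem_bdry {U : Finset Site} {e : Site × Site} :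
    e ∈ bdry U ↔ adjP e.1 e.2 ∧ e.1 ∈ U ∧ e.2 ∉ U := by
  obtain ⟨x, y⟩ := e
  simp only [bdry, Finset.mem_filter, Finset.mem_biUnion, Finset.mem_image, adjP_iff]
  constructor
  · rintro ⟨⟨z, hz, w, hw, h⟩, h2⟩
    simp only [Prod.mk.injEq] at h
    obtain ⟨rfl, rfl⟩ := h
    exact ⟨hw, hz, h2⟩
  · rintro ⟨h1, h2, h3⟩
    exact ⟨⟨x, h2, y, h1, rfl⟩, h3⟩

def etail (e : Site × Site) : Site :=
  (e.1.1 + ((e.2.1-e.1.1)+(e.2.2-e.1.2)-1)/2, e.1.2 + ((e.2.2-e.1.2)-(e.2.1-e.1.1)-1)/2)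

def ehead (e : Site × Site) : Site :=
  ((etail e).1 - (e.2.2-e.1.2), (etail e).2 + (e.2.1-e.1.1))

def cross (e : Site × Site) (x : Site) : ℤ :=
  if e.1.2 = x.2 ∧ e.2.2 = x.2 then
    (if e.2.1 = e.1.1+1 ∧ x.1 ≤ e.1.1 then 1
     else if e.2.1 = e.1.1-1 ∧ x.1 ≤ e.2.1 then -1 else 0) else 0

def gfun (x c : Site) : ℤ := if c.2 = x.2 ∧ x.1 ≤ c.1 then 1 else 0

lemma cross_H {e : Site × Site} (he : adjP e.1 e.2) (x : Site) :
    cross e x - cross e (x.1+1,x.2) =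
      (if e = (x,(x.1+1,x.2)) then 1 else 0) - (if e = ((x.1+1,x.2),x) then 1 else 0) := by
  have h := adjP_cases he
  obtain ⟨⟨a,b⟩,⟨c,d⟩⟩ := e
  obtain ⟨u,v⟩ := x
  simp only [cross, Prod.mk.injEq] at *
  split_ifs <;> omega

lemma cross_V {e : Site × Site} (he : adjP e.1 e.2) (x : Site) :
    cross e x - cross e (x.1,x.2+1) = gfun x (ehead e) - gfun x (etail e) +
      ((if e = (x,(x.1,x.2+1)) then 1 else 0) - (if e = ((x.1,x.2+1),x) then 1 else 0)) := by
  have h := adjP_cases he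
  obtain ⟨⟨a,b⟩,⟨c,d⟩⟩ := e
  obtain ⟨u,v⟩ := x
  simp only [cross, gfun, ehead, etail, Prod.mk.injEq] at *
  rcases h with h | h | h | h
  · have e1 : (c - a + (d - b) - 1) / 2 = 0 := by omega
    have e2 : (d - b - (c - a) - 1) / 2 = -1 := by omega
    simp only [e1, e2]; split_ifs <;> omega
  · have e1 : (c - a + (d - b) - 1) / 2 = 0 := by omega
    have e2 : (d - b - (c - a) - 1) / 2 = 0 := by omega
    simp only [e1, e2]; split_ifs <;> omega
  · have e1 : (c - a + (d - b) - 1) / 2 = -1 := by omega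
    have e2 : (d - b - (c - a) - 1) / 2 = 0 := by omega
    simp only [e1, e2]; split_ifs <;> omega
  · have e1 : (c - a + (d - b) - 1) / 2 = -1 := by omega
    have e2 : (d - b - (c - a) - 1) / 2 = -1 := by omega
    simp only [e1, e2]; split_ifs <;> omega

def wind (γ : Finset (Site × Site)) (x : Site) : ℤ := ∑ e ∈ γ, cross e x

lemma wind_H {γ : Finset (Site × Site)} (hγ : ∀ e ∈ γ, adjP e.1 e.2) (x : Site) :
    wind γ x - wind γ (x.1+1,x.2) =
      (if (x,(x.1+1,x.2)) ∈ γ then 1 else 0) - (if ((x.1+1,x.2),x) ∈ γ then 1 else 0) := by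
  unfold wind
  rw [← Finset.sum_sub_distrib, Finset.sum_congr rfl (fun e he => cross_H (hγ e he) x),
    Finset.sum_sub_distrib]
  simp

def EBal (γ : Finset (Site × Site)) : Prop :=
  ∀ φ : Site → ℤ, ∑ e ∈ γ, φ (ehead e) = ∑ e ∈ γ, φ (etail e)

lemma wind_V {γ : Finset (Site × Site)} (hγ : ∀ e ∈ γ, adjP e.1 e.2) (hb : EBal γ) (x : Site) :
    wind γ x - wind γ (x.1,x.2+1) =
      (if (x,(x.1,x.2+1)) ∈ γ then 1 else 0) - (if ((x.1,x.2+1),x) ∈ γ then 1 else 0) := by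
  unfold wind
  rw [← Finset.sum_sub_distrib, Finset.sum_congr rfl (fun e he => cross_V (hγ e he) x),
    Finset.sum_add_distrib, Finset.sum_sub_distrib, hb (gfun x), Finset.sum_sub_distrib]
  simp

lemma wind_adj {γ : Finset (Site × Site)} (hγ : ∀ e ∈ γ, adjP e.1 e.2) (hb : EBal γ)
    {x y : Site} (h : adjP x y) :
    wind γ x - wind γ y = (if (x,y) ∈ γ then 1 else 0) - (if (y,x) ∈ γ then 1 else 0) := by
  have h' := adjP_cases h
  rcases h' with h | h | h | h
  · have : y = (x.1+1,x.2) := Prod.ext h.1 h.2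
    subst this; exact wind_H hγ x
  · have : y = (x.1,x.2+1) := Prod.ext h.1 h.2
    subst this; exact wind_V hγ hb x
  · have : x = (y.1+1,y.2) := Prod.ext (by simp; omega) (by simp; omega)
    have h3 := wind_H hγ y
    rw [← this] at h3; omega
  · have : x = (y.1,y.2+1) := Prod.ext (by simp; omega) (by simp; omega)
    have h3 := wind_V hγ hb y
    rw [← this] at h3; omega

/-- bounding radius -/
lemma exists_radius (γ : Finset (Site × Site)) : ∃ R : ℤ, 0 ≤ R ∧ ∀ e ∈ γ, |e.1.1| ≤ R ∧ |e.1.2| ≤ R ∧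
    |e.2.1| ≤ R ∧ |e.2.2| ≤ R := by
  induction γ using Finset.induction_on with
  | empty => exact ⟨0, le_rfl, by simp⟩
  | insert a s ha ih =>
    obtain ⟨R, h0, hR⟩ := ih
    refine ⟨R + |a.1.1| + |a.1.2| + |a.2.1| + |a.2.2|, by positivity, ?_⟩
    have p1 := abs_nonneg a.1.1
    have p2 := abs_nonneg a.1.2
    have p3 := abs_nonneg a.2.1
    have p4 := abs_nonneg a.2.2
    intro e he
    rcases Finset.mem_insert.1 he with rfl | he
    · refine ⟨?_, ?_, ?_, ?_⟩ <;> linarith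
    · obtain ⟨q1, q2, q3, q4⟩ := hR e he
      refine ⟨?_, ?_, ?_, ?_⟩ <;> linarith

lemma wind_right {γ : Finset (Site × Site)} {R : ℤ} (hR : ∀ e ∈ γ, |e.1.1| ≤ R ∧ |e.1.2| ≤ R ∧
    |e.2.1| ≤ R ∧ |e.2.2| ≤ R) {x : Site} (hx : R < x.1 ∨ R < x.2 ∨ x.2 < -R) : wind γ x = 0 := by
  apply Finset.sum_eq_zero
  intro e he
  obtain ⟨q1, q2, q3, q4⟩ := hR e he
  rw [abs_le] at q1 q2 q3 q4
  unfold cross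
  split_ifs <;> omega

lemma wind_left {γ : Finset (Site × Site)} (hγ : ∀ e ∈ γ, adjP e.1 e.2) (hb : EBal γ) {R : ℤ}
    (hR : ∀ e ∈ γ, |e.1.1| ≤ R ∧ |e.1.2| ≤ R ∧
    |e.2.1| ≤ R ∧ |e.2.2| ≤ R) {x : Site} (hx : x.1 < -R) : wind γ x = 0 := by
  have key : ∀ n : ℕ, wind γ x = wind γ (x.1, x.2 + n) := by
    intro n
    induction n with
    | zero => simp
    | succ n ih =>
      rw [ih]
      have := wind_V hγ hb (x.1, x.2 + n)
      rw [if_neg, if_neg] at this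
      · push_cast; rw [← add_assoc]; simp only at this; linarith
      · intro h; have := (hR _ h).1; rw [abs_le] at this; simp at this; omega
      · intro h; have := (hR _ h).1; rw [abs_le] at this; simp at this; omega
  rw [key (R - x.2 + 1).toNat]
  apply wind_right hR
  right; left; simp only; omega

lemma wind_support {γ : Finset (Site × Site)} (hγ : ∀ e ∈ γ, adjP e.1 e.2) (hb : EBal γ) :
    ∃ S : Finset Site, ∀ x, wind γ x ≠ 0 → x ∈ S := by
  obtain ⟨R, h0, hR⟩ := exists_radius γ
  refine ⟨Finset.Icc (-R) R ×ˢ Finset.Icc (-R) R, fun x hx => ?_⟩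
  by_contra hc
  simp only [Finset.mem_product, Finset.mem_Icc] at hc
  apply hx
  by_cases h1 : x.1 < -R
  · exact wind_left hγ hb hR h1
  · apply wind_right hR; omega

lemma wind_bdry (U : Finset Site) (x : Site) : wind (bdry U) x = if x ∈ U then 1 else 0 := by
  obtain ⟨R, h0, hR⟩ := exists_radius (bdry U)
  obtain ⟨R', h0', hR'⟩ := exists_radius (U.image fun x => (x,x))
  have hγ : ∀ e ∈ bdry U, adjP e.1 e.2 := fun e he => (mem_bdry.1 he).1
  have key : ∀ n : ℕ, wind (bdry U) x - (if x ∈ U then 1 else 0) =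
      wind (bdry U) (x.1 + n, x.2) - (if (x.1 + (n:ℤ), x.2) ∈ U then 1 else 0) := by
    intro n
    induction n with
    | zero => simp
    | succ n ih =>
      rw [ih]
      have := wind_H hγ (x.1 + n, x.2)
      simp only [mem_bdry] at this
      have a1 : adjP (x.1 + (n:ℤ), x.2) (x.1 + (n:ℤ) + 1, x.2) := adjP_of_cases (by simp)
      have a2 := adjP_comm.1 a1
      simp only [a1, a2, true_and] at this
      push_cast
      rw [← add_assoc]
      by_cases u1 : (x.1 + (n:ℤ), x.2) ∈ U <;> by_cases u2 : (x.1 + (n:ℤ) + 1, x.2) ∈ U <;>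
        simp only [u1, u2, if_true, if_false, not_true, not_false_iff, and_true, and_false,
          true_and, false_and] at this ⊢ <;> omega
  have h := key (R + R' - x.1 + 1 + |x.1|).toNat
  have hx := le_abs_self x.1
  have hx2 := neg_abs_le x.1
  have z1 : wind (bdry U) (x.1 + ((R + R' - x.1 + 1 + |x.1|).toNat : ℤ), x.2) = 0 :=
    wind_right hR (by left; show R < x.1 + _; omega)
  have z2 : (x.1 + ((R + R' - x.1 + 1 + |x.1|).toNat : ℤ), x.2) ∉ U := by
    intro hm
    have := (hR' _ (Finset.mem_image_of_mem _ hm)).1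
    rw [abs_le] at this
    have := this.2
    change x.1 + _ ≤ R' at this
    omega
  rw [z1, if_neg z2] at h
  linarith

lemma bdry_out (U : Finset Site) (c : Site) :
    ((bdry U).filter (fun e => etail e = c)).card = ((bdry U).filter (fun e => ehead e = c)).card := by
  obtain ⟨a, b⟩ := c
  have h1 : (bdry U).filter (fun e => etail e = (a,b)) =
      ({((a,b+1),(a+1,b+1)), ((a,b),(a,b+1)), ((a+1,b),(a,b)), ((a+1,b+1),(a+1,b))} :
        Finset (Site × Site)).filter (fun e => e.1 ∈ U ∧ e.2 ∉ U) := by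
    ext ⟨⟨u,v⟩,⟨w,z⟩⟩
    simp only [Finset.mem_filter, mem_bdry, Finset.mem_insert, Finset.mem_singleton, Prod.mk.injEq,
      etail]
    constructor
    · rintro ⟨⟨h, h2⟩, h3⟩
      refine ⟨?_, h2⟩
      have := adjP_cases h
      simp only at this
      rcases this with this | this | this | this
      · left; omega
      · right; left; omega
      · right; right; left; omega
      · right; right; right; omega
    · rintro ⟨h, h2⟩
      rcases h with h | h | h | h
      · exact ⟨⟨adjP_of_cases (by simp only; left; omega), h2⟩, by omega⟩
      · exact ⟨⟨adjP_of_cases (by simp only; right; left; omega), h2⟩, by omega⟩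
      · exact ⟨⟨adjP_of_cases (by simp only; right; right; left; omega), h2⟩, by omega⟩
      · exact ⟨⟨adjP_of_cases (by simp only; right; right; right; omega), h2⟩, by omega⟩
  have h2 : (bdry U).filter (fun e => ehead e = (a,b)) =
      ({((a,b),(a+1,b)), ((a+1,b),(a+1,b+1)), ((a+1,b+1),(a,b+1)), ((a,b+1),(a,b))} :
        Finset (Site × Site)).filter (fun e => e.1 ∈ U ∧ e.2 ∉ U) := by
    ext ⟨⟨u,v⟩,⟨w,z⟩⟩
    simp only [Finset.mem_filter, mem_bdry, Finset.mem_insert, Finset.mem_singleton, Prod.mk.injEq,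
      etail, ehead]
    constructor
    · rintro ⟨⟨h, h2⟩, h3⟩
      refine ⟨?_, h2⟩
      have := adjP_cases h
      simp only at this
      rcases this with this | this | this | this
      · left; omega
      · right; left; omega
      · right; right; left; omega
      · right; right; right; omega
    · rintro ⟨h, h2⟩
      rcases h with h | h | h | h
      · exact ⟨⟨adjP_of_cases (by simp only; left; omega), h2⟩, by omega⟩
      · exact ⟨⟨adjP_of_cases (by simp only; right; left; omega), h2⟩, by omega⟩
      · exact ⟨⟨adjP_of_cases (by simp only; right; right; left; omega), h2⟩, by omega⟩
      · exact ⟨⟨adjP_of_cases (by simp only; right; right; right; omega), h2⟩, by omega⟩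
  rw [h1, h2, Finset.card_filter, Finset.card_filter]
  rw [Finset.sum_insert, Finset.sum_insert, Finset.sum_insert, Finset.sum_singleton,
    Finset.sum_insert, Finset.sum_insert, Finset.sum_insert, Finset.sum_singleton]
  · by_cases u1 : (a,b) ∈ U <;> by_cases u2 : (a+1,b) ∈ U <;> by_cases u3 : (a,b+1) ∈ U <;>
      by_cases u4 : (a+1,b+1) ∈ U <;> simp [u1,u2,u3,u4]
  all_goals simp

lemma exists_perm (U : Finset Site) : ∃ σ : Equiv.Perm (bdry U), ∀ e, etail (σ e).1 = ehead e.1 := by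
  have hc : ∀ c : Site, Nonempty ({e : bdry U // ehead e.1 = c} ≃ {e : bdry U // etail e.1 = c}) := by
    intro c
    refine ⟨Fintype.equivOfCardEq ?_⟩
    rw [Fintype.card_subtype, Fintype.card_subtype, Finset.card_filter, Finset.card_filter,
      Finset.sum_coe_sort (bdry U) (fun e => if ehead e = c then 1 else 0),
      Finset.sum_coe_sort (bdry U) (fun e => if etail e = c then 1 else 0),
      ← Finset.card_filter, ← Finset.card_filter]
    exact (bdry_out U c).symm
  let F := fun c => (hc c).some
  refine ⟨((Equiv.sigmaFiberEquiv (fun e : bdry U => ehead e.1)).symm.trans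
    (Equiv.sigmaCongrRight F)).trans (Equiv.sigmaFiberEquiv (fun e : bdry U => etail e.1)), ?_⟩
  intro e
  exact (F (ehead e.1) ⟨e, rfl⟩).2

def Good (U : Finset Site) : Prop :=
  ∃ σ : Equiv.Perm (bdry U), (∀ e, etail (σ e).1 = ehead e.1) ∧ ∀ e e', σ.SameCycle e e'

lemma exists_sub (U : Finset Site) (x0 : Site) (hx : x0 ∈ U) (σ : Equiv.Perm (bdry U))
    (hσ : ∀ e, etail (σ e).1 = ehead e.1) :
    ∃ U' : Finset Site, x0 ∈ U' ∧ bdry U' ⊆ bdry U ∧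
      ((bdry U').card = (bdry U).card → ∀ e e', σ.SameCycle e e') := by
  have hw : ∑ e : bdry U, cross e.1 x0 = 1 := by
    rw [Finset.sum_coe_sort (bdry U) (fun e => cross e x0)]
    have := wind_bdry U x0
    rwa [if_pos hx] at this
  let s := Equiv.Perm.SameCycle.setoid σ
  have hw2 := Finset.sum_fiberwise (Finset.univ : Finset (bdry U)) (fun e => (Quotient.mk s e))
    (fun e => cross e.1 x0)
  rw [hw] at hw2
  obtain ⟨q, hq⟩ : ∃ q : Quotient s, 1 ≤ ∑ e : bdry U with Quotient.mk s e = q, cross e.1 x0 := by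
    by_contra hcon
    push Not at hcon
    have h0 : ∑ q : Quotient s, ∑ e : bdry U with Quotient.mk s e = q, cross e.1 x0 ≤ 0 :=
      Finset.sum_nonpos (fun q _ => by have := hcon q; omega)
    rw [hw2] at h0
    omega
  obtain ⟨e0, rfl⟩ := Quotient.exists_rep q
  set O : Finset (bdry U) := Finset.univ.filter (fun e => Quotient.mk s e = Quotient.mk s e0) with hO
  have hmem : ∀ e, e ∈ O ↔ σ.SameCycle e e0 := by
    intro e
    rw [hO, Finset.mem_filter]
    simp only [Finset.mem_univ, true_and]
    exact Quotient.eq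
  set γ : Finset (Site × Site) := O.map (Function.Embedding.subtype _) with hγd
  have hγU : γ ⊆ bdry U := by
    intro e he
    rw [hγd, Finset.mem_map] at he
    obtain ⟨a, _, rfl⟩ := he
    exact a.2
  have hγ : ∀ e ∈ γ, adjP e.1 e.2 := fun e he => (mem_bdry.1 (hγU he)).1
  have hb : EBal γ := by
    intro φ
    rw [hγd, Finset.sum_map, Finset.sum_map]
    apply Finset.sum_equiv σ
    · intro e
      rw [hmem, hmem, Equiv.Perm.sameCycle_apply_left]
    · intro e _
      simp [hσ]
  have hwx : 1 ≤ wind γ x0 := by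
    unfold wind
    rw [hγd, Finset.sum_map]
    exact hq
  obtain ⟨S, hS⟩ := wind_support hγ hb
  have hsub : bdry (S.filter (fun x => 1 ≤ wind γ x)) ⊆ γ := by
    intro e he
    rw [mem_bdry] at he
    obtain ⟨h1, h2, h3⟩ := he
    have h4 := (Finset.mem_filter.1 h2).2
    have h5 : ¬ 1 ≤ wind γ e.2 := by
      intro h
      exact h3 (Finset.mem_filter.2 ⟨hS _ (by omega), h⟩)
    have h6 := wind_adj hγ hb h1
    by_contra hc
    rw [if_neg hc] at h6
    split_ifs at h6 <;> omega
  refine ⟨S.filter (fun x => 1 ≤ wind γ x), Finset.mem_filter.2 ⟨hS _ (by omega), hwx⟩,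
    hsub.trans hγU, ?_⟩
  intro hcard
  have h1 := Finset.card_le_card hsub
  have h2 : γ = bdry U := Finset.eq_of_subset_of_card_le hγU (by omega)
  have h3 : ∀ e : bdry U, σ.SameCycle e e0 := by
    intro e
    have : e.1 ∈ γ := by rw [h2]; exact e.2
    rw [hγd, Finset.mem_map] at this
    obtain ⟨a, ha, hae⟩ := this
    have : a = e := Subtype.ext hae
    rw [← this]; exact (hmem a).1 ha
  intro e e'
  exact (h3 e).trans (h3 e').symm

lemma exists_good (A : Finset Site) (x0 : Site) (hx : x0 ∈ A) :
    ∃ U : Finset Site, x0 ∈ U ∧ bdry U ⊆ bdry A ∧ Good U := by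
  have hex : ∃ n, ∃ U : Finset Site, x0 ∈ U ∧ bdry U ⊆ bdry A ∧ (bdry U).card = n :=
    ⟨_, A, hx, subset_rfl, rfl⟩
  obtain ⟨U, h1, h2, h3⟩ := Nat.find_spec hex
  obtain ⟨σ, hσ⟩ := exists_perm U
  refine ⟨U, h1, h2, σ, hσ, ?_⟩
  obtain ⟨U', h4, h5, h6⟩ := exists_sub U x0 h1 σ hσ
  apply h6
  apply le_antisymm (Finset.card_le_card h5)
  rw [h3]
  exact Nat.find_min' hex ⟨U', h4, h5.trans h2, rfl⟩

lemma Good.walk {U : Finset Site} (h : Good U) (e0 : Site × Site) (he0 : e0 ∈ bdry U) :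
    ∃ g : ℕ → Site × Site, g 0 = e0 ∧ (∀ i, g i ∈ bdry U) ∧ (∀ i, etail (g (i+1)) = ehead (g i)) ∧
      ∀ e ∈ bdry U, ∃ i < (bdry U).card, g i = e := by
  obtain ⟨σ, h1, h2⟩ := h
  refine ⟨fun i => ((σ ^ i) ⟨e0, he0⟩).1, rfl, fun i => ((σ ^ i) ⟨e0, he0⟩).2, ?_, ?_⟩
  · intro i
    show etail ((σ ^ (i+1)) ⟨e0, he0⟩).1 = ehead ((σ ^ i) ⟨e0, he0⟩).1
    rw [pow_succ', Equiv.Perm.mul_apply, h1]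
  · intro e he
    have hc : σ.IsCycleOn (Finset.univ : Finset (bdry U)) := by
      refine ⟨?_, fun x _ y _ => h2 x y⟩
      simp only [Finset.coe_univ]
      exact Set.bijOn_univ.2 σ.bijective
    obtain ⟨n, hn, hn2⟩ := hc.exists_pow_eq (Finset.mem_univ ⟨e0, he0⟩) (Finset.mem_univ ⟨e, he⟩)
    refine ⟨n, by simpa using hn, ?_⟩
    simp only [hn2]

lemma Good.dist {U : Finset Site} (h : Good U) {e e' : Site × Site} (he : e ∈ bdry U)
    (he' : e' ∈ bdry U) : |(etail e').1 - (etail e).1| + 1 ≤ (bdry U).card ∧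
      |(etail e').2 - (etail e).2| + 1 ≤ (bdry U).card := by
  obtain ⟨g, g0, gm, gs, ge⟩ := h.walk e he
  have key : ∀ i : ℕ, |(etail (g i)).1 - (etail e).1| ≤ i ∧ |(etail (g i)).2 - (etail e).2| ≤ i := by
    intro i
    induction i with
    | zero => simp [g0]
    | succ i ih =>
      rw [gs i]
      have := adjP_cases (mem_bdry.1 (gm i)).1
      simp only [ehead]
      rw [abs_le, abs_le] at ih ⊢
      push_cast
      omega
  obtain ⟨i, hi, rfl⟩ := ge e' he'
  obtain ⟨k1, k2⟩ := key i
  constructor <;> omega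

lemma exit_right {U : Finset Site} {x : Site} (hx : x ∈ U) :
    ∃ k : ℕ, ((x.1 + (k:ℤ), x.2), (x.1 + (k:ℤ) + 1, x.2)) ∈ bdry U := by
  by_contra hcon
  push Not at hcon
  have key : ∀ k : ℕ, (x.1 + (k:ℤ), x.2) ∈ U := by
    intro k
    induction k with
    | zero => simpa using hx
    | succ k ih =>
      by_contra h
      apply hcon k
      rw [mem_bdry]
      refine ⟨adjP_of_cases (by simp), ih, ?_⟩
      push_cast at h
      rwa [← add_assoc] at h
  have : Set.Infinite (U : Set Site) := by
    apply Set.infinite_of_injective_forall_mem (f := fun k : ℕ => (x.1 + (k:ℤ), x.2)) _ key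
    intro a b hab
    simpa using hab
  exact this U.finite_toSet

lemma exit_left {U : Finset Site} {x : Site} (hx : x ∈ U) :
    ∃ k : ℕ, ((x.1 - (k:ℤ), x.2), (x.1 - (k:ℤ) - 1, x.2)) ∈ bdry U := by
  by_contra hcon
  push Not at hcon
  have key : ∀ k : ℕ, (x.1 - (k:ℤ), x.2) ∈ U := by
    intro k
    induction k with
    | zero => simpa using hx
    | succ k ih =>
      by_contra h
      apply hcon k
      rw [mem_bdry]
      refine ⟨adjP_of_cases (by simp), ih, ?_⟩
      push_cast at h
      rwa [← sub_sub] at h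
  have : Set.Infinite (U : Set Site) := by
    apply Set.infinite_of_injective_forall_mem (f := fun k : ℕ => (x.1 - (k:ℤ), x.2)) _ key
    intro a b hab
    simpa using hab
  exact this U.finite_toSet

lemma Good.start {U : Finset Site} (h : Good U) {x : Site} (hx : x ∈ U) :
    ∃ k : ℕ, k < (bdry U).card ∧ ((x.1 + (k:ℤ), x.2), (x.1 + (k:ℤ) + 1, x.2)) ∈ bdry U := by
  obtain ⟨k, hk⟩ := exit_right hx
  obtain ⟨m, hm⟩ := exit_left hx
  refine ⟨k, ?_, hk⟩
  have := (h.dist hk hm).1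
  simp only [etail] at this
  rcases abs_cases (x.1 - ↑m + (x.1 - ↑m - 1 - (x.1 - ↑m) + (x.2 - x.2) - 1) / 2 -
          (x.1 + ↑k + (x.1 + ↑k + 1 - (x.1 + ↑k) + (x.2 - x.2) - 1) / 2)) with h | h <;> omega

lemma Good.box {U : Finset Site} (h : Good U) {x y : Site} (hx : x ∈ U) (hy : y ∈ U) :
    y.1 - x.1 < (bdry U).card ∧ y.2 - x.2 < (bdry U).card := by
  obtain ⟨k, hk⟩ := exit_right hy
  obtain ⟨m, hm⟩ := exit_left hx
  obtain ⟨k', hk'⟩ := exit_right hx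
  have h1 := (h.dist hm hk).1
  have h2 := (h.dist hk' hk).2
  have h3 := le_trans (add_le_add_left (le_abs_self _) 1) h1
  have h4 := le_trans (add_le_add_left (le_abs_self _) 1) h2
  simp only [etail] at h3 h4
  omega

def edgeAt (c s : Site) : Site × Site :=
  ((c.1 - (s.2 + (-s.1) - 1)/2, c.2 - ((-s.1) - s.2 - 1)/2),
   (c.1 - (s.2 + (-s.1) - 1)/2 + s.2, c.2 - ((-s.1) - s.2 - 1)/2 - s.1))

def estep (e : Site × Site) : Site := (-(e.2.2 - e.1.2), e.2.1 - e.1.1)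

lemma edgeAt_eq (e : Site × Site) : edgeAt (etail e) (estep e) = e := by
  obtain ⟨⟨a,b⟩,⟨c,d⟩⟩ := e
  simp only [edgeAt, etail, estep, Prod.mk.injEq, neg_neg]
  omega

def dirv : Fin 4 → Site := ![(1,0),(0,1),(-1,0),(0,-1)]

lemma exists_dirv {e : Site × Site} (h : adjP e.1 e.2) : ∃ i, dirv i = estep e := by
  have := adjP_cases h
  unfold estep
  rcases this with h | h | h | h
  · exact ⟨1, Prod.ext (by simp [dirv]; omega) (by simp [dirv]; omega)⟩
  · exact ⟨2, Prod.ext (by simp [dirv]; omega) (by simp [dirv]; omega)⟩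
  · exact ⟨3, Prod.ext (by simp [dirv]; omega) (by simp [dirv]; omega)⟩
  · exact ⟨0, Prod.ext (by simp [dirv]; omega) (by simp [dirv]; omega)⟩

def wstep {n : ℕ} (f : Fin n → Fin 4) (i : ℕ) : Site := if h : i < n then dirv (f ⟨i, h⟩) else 0

def decode (x0 : Site) (n : ℕ) (q : Fin n × (Fin n → Fin 4)) : Finset (Site × Site) :=
  (Finset.range n).image fun i =>
    edgeAt ((x0.1 + ((q.1 : ℕ) : ℤ), x0.2 - 1) + ∑ j ∈ Finset.range i, wstep q.2 j) (wstep q.2 i)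

lemma count_good (x0 : Site) (n : ℕ) (𝒰 : Finset (Finset Site))
    (h : ∀ U ∈ 𝒰, x0 ∈ U ∧ Good U ∧ (bdry U).card = n) : 𝒰.card ≤ n * 4 ^ n := by
  have hinj : Set.InjOn bdry (𝒰 : Set (Finset Site)) := by
    intro U _ V _ hUV
    ext x
    have h1 := wind_bdry U x
    have h2 := wind_bdry V x
    rw [hUV, h2] at h1
    split_ifs at h1 <;> simp_all
  rw [← Finset.card_image_of_injOn hinj]
  have hsub : 𝒰.image bdry ⊆ (Finset.univ : Finset (Fin n × (Fin n → Fin 4))).image (decode x0 n) := by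
    intro γ hγ
    rw [Finset.mem_image] at hγ
    obtain ⟨U, hU, rfl⟩ := hγ
    obtain ⟨hx, hG, hc⟩ := h U hU
    obtain ⟨k, hk, hke⟩ := hG.start hx
    obtain ⟨g, g0, gm, gs, ge⟩ := hG.walk _ hke
    choose d hd using fun i => exists_dirv (mem_bdry.1 (gm i)).1
    rw [hc] at hk ge
    rw [Finset.mem_image]
    refine ⟨(⟨k, hk⟩, fun i => d i), Finset.mem_univ _, ?_⟩
    have hpos : ∀ i ≤ n, (x0.1 + (k : ℤ), x0.2 - 1) +
        ∑ j ∈ Finset.range i, wstep (fun i : Fin n => d i) j = etail (g i) := by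
      intro i hi
      induction i with
      | zero =>
        rw [g0]
        simp [etail]; ring
      | succ i ih =>
        rw [Finset.sum_range_succ, ← add_assoc, ih (by omega), gs, wstep, dif_pos (by omega), hd]
        apply Prod.ext <;> simp [ehead, estep]; ring
    have himg : decode x0 n (⟨k, hk⟩, fun i => d i) = (Finset.range n).image g := by
      unfold decode
      apply Finset.image_congr
      intro i hi
      have hi := Finset.mem_range.1 hi
      simp only
      rw [hpos i (by omega), wstep, dif_pos hi, hd, edgeAt_eq]
    rw [himg]
    ext e
    rw [Finset.mem_image]
    constructor
    · rintro ⟨i, _, rfl⟩; exact gm i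
    · intro he
      obtain ⟨i, hi, hie⟩ := ge e he
      exact ⟨i, Finset.mem_range.2 hi, hie⟩
  calc _ ≤ _ := Finset.card_le_card hsub
    _ ≤ _ := Finset.card_image_le
    _ = _ := by simp

lemma sum_rpow_bound (α : ℝ) (h0 : 0 < α) (h1 : α < 1) (N : ℕ) :
    ∑ n ∈ Finset.range N, ((n:ℝ)+1) ^ (-α) ≤ (N:ℝ) ^ (1-α) / (1-α) := by
  induction N with
  | zero => simp; rw [Real.zero_rpow (by linarith)]; simp
  | succ N ih =>
    rw [Finset.sum_range_succ]
    have hN : (0:ℝ) < (N:ℝ) + 1 := by positivity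
    have hpos : 0 < 1 - α := by linarith
    have hb := rpow_one_add_le_one_add_mul_self (s := -1/((N:ℝ)+1)) (p := 1-α)
      (by rw [le_div_iff₀ hN]; nlinarith [Nat.cast_nonneg (α := ℝ) N]) hpos.le (by linarith)
    have e1 : 1 + -1/((N:ℝ)+1) = N / (N+1) := by field_simp; ring
    rw [e1, Real.div_rpow (by positivity) hN.le, div_le_iff₀ (by positivity)] at hb
    have e2 : ((N:ℝ)+1) ^ (1-α) = ((N:ℝ)+1) ^ (-α) * (N+1) := by
      rw [show 1 - α = -α + 1 by ring, Real.rpow_add hN, Real.rpow_one]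
    have e3 : (1 + (1-α) * (-1/((N:ℝ)+1))) * ((N:ℝ)+1) ^ (1-α) =
        ((N:ℝ)+1) ^ (1-α) - (1-α) * ((N:ℝ)+1) ^ (-α) := by
      rw [e2]; field_simp; ring
    rw [e3] at hb
    push_cast
    rw [le_div_iff₀ hpos] at ih ⊢
    linarith

def lavg (J : ℕ → ℕ → ℝ) (n : ℕ) : ℝ := (∑ a ∈ Finset.range (n+1), J a (n-a)) / ((n:ℝ)+1)

lemma lavg_succ (J : ℕ → ℕ → ℝ) (n : ℕ) :
    lavg J (n+1) * (((n:ℝ)+1) * (n+2)) = ∑ a ∈ Finset.range (n+1),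
      (((a:ℝ)+1) * J (a+1) (n-a) + ((n:ℝ)+1-a) * J a (n-a+1)) := by
  unfold lavg
  have h1 : ((n+1:ℕ):ℝ) + 1 = n + 2 := by push_cast; ring
  rw [h1]
  have h2 : (∑ a ∈ Finset.range (n+1+1), J a (n+1-a)) / ((n:ℝ)+2) * (((n:ℝ)+1)*(n+2)) =
      ∑ a ∈ Finset.range (n+1+1), ((a:ℝ) * J a (n+1-a) + ((n:ℝ)+1-a) * J a (n+1-a)) := by
    rw [div_mul_eq_mul_div, div_eq_iff (by positivity)]
    rw [Finset.sum_congr rfl (fun (a:ℕ) _ => show ((a:ℝ) * J a (n+1-a) + ((n:ℝ)+1-a) * J a (n+1-a)) =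
      ((n:ℝ)+1) * J a (n+1-a) by ring), ← Finset.mul_sum]
    ring
  rw [h2, Finset.sum_add_distrib, Finset.sum_add_distrib]
  congr 1
  · rw [Finset.sum_range_succ']
    simp
  · rw [Finset.sum_range_succ]
    push_cast
    rw [sub_self, zero_mul, add_zero]
    apply Finset.sum_congr rfl
    intro a ha
    have := Finset.mem_range.1 ha
    rw [show n + 1 - a = n - a + 1 by omega]

lemma lavg_step (J : ℕ → ℕ → ℝ) (n : ℕ) :
    lavg J n - lavg J (n+1) ≤ 1/((n:ℝ)+1) * ∑ a ∈ Finset.range (n+1),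
      (|J a (n-a) - J (a+1) (n-a)| + |J a (n-a) - J a (n-a+1)|) := by
  have hn : (0:ℝ) < (n:ℝ)+1 := by positivity
  have hn2 : (0:ℝ) < (n:ℝ)+2 := by positivity
  have h1 : lavg J n * (((n:ℝ)+1)*(n+2)) = ∑ a ∈ Finset.range (n+1),
      (((a:ℝ)+1) * J a (n-a) + ((n:ℝ)+1-a) * J a (n-a)) := by
    unfold lavg
    rw [div_mul_eq_mul_div, div_eq_iff (by positivity)]
    rw [Finset.sum_congr rfl (fun (a:ℕ) _ => show ((a:ℝ)+1) * J a (n-a) + ((n:ℝ)+1-a) * J a (n-a) =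
      ((n:ℝ)+2) * J a (n-a) by ring), ← Finset.mul_sum]
    ring
  have h2 : (lavg J n - lavg J (n+1)) * (((n:ℝ)+1)*(n+2)) ≤ (1/((n:ℝ)+1) * ∑ a ∈ Finset.range (n+1),
      (|J a (n-a) - J (a+1) (n-a)| + |J a (n-a) - J a (n-a+1)|)) * (((n:ℝ)+1)*(n+2)) := by
    rw [sub_mul, h1, lavg_succ, ← Finset.sum_sub_distrib]
    have : (1/((n:ℝ)+1) * ∑ a ∈ Finset.range (n+1),
      (|J a (n-a) - J (a+1) (n-a)| + |J a (n-a) - J a (n-a+1)|)) * (((n:ℝ)+1)*(n+2)) =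
      ∑ a ∈ Finset.range (n+1), ((n:ℝ)+2) * (|J a (n-a) - J (a+1) (n-a)| + |J a (n-a) - J a (n-a+1)|) := by
      rw [← Finset.mul_sum]; field_simp
    rw [this]
    apply Finset.sum_le_sum
    intro a ha
    have ha' : (a:ℝ) ≤ n := by
      have := Finset.mem_range.1 ha
      exact_mod_cast (by omega : a ≤ n)
    have ha0 : (0:ℝ) ≤ a := by positivity
    have q1 := le_abs_self (J a (n-a) - J (a+1) (n-a))
    have q2 := le_abs_self (J a (n-a) - J a (n-a+1))
    have q3 := abs_nonneg (J a (n-a) - J (a+1) (n-a))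
    have q4 := abs_nonneg (J a (n-a) - J a (n-a+1))
    have r1 : ((a:ℝ)+1) * (J a (n-a) - J (a+1) (n-a)) ≤ (n+2) * |J a (n-a) - J (a+1) (n-a)| := by
      calc _ ≤ ((a:ℝ)+1) * |J a (n-a) - J (a+1) (n-a)| := by gcongr
        _ ≤ _ := by gcongr; linarith
    have r2 : ((n:ℝ)+1-a) * (J a (n-a) - J a (n-a+1)) ≤ (n+2) * |J a (n-a) - J a (n-a+1)| := by
      calc _ ≤ ((n:ℝ)+1-a) * |J a (n-a) - J a (n-a+1)| := by
            apply mul_le_mul_of_nonneg_left q2; linarith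
        _ ≤ _ := by apply mul_le_mul_of_nonneg_right _ q4; linarith
    linarith
  exact le_of_mul_le_mul_right h2 (by positivity)

lemma flow (J : ℕ → ℕ → ℝ) (N : ℕ) (hN : ∀ a b, a + b = N → J a b = 0) :
    J 0 0 ≤ ∑ n ∈ Finset.range N, 1/((n:ℝ)+1) * ∑ a ∈ Finset.range (n+1),
      (|J a (n-a) - J (a+1) (n-a)| + |J a (n-a) - J a (n-a+1)|) := by
  have h0 : lavg J 0 = J 0 0 := by simp [lavg]
  have h1 : lavg J N = 0 := by
    unfold lavg
    rw [Finset.sum_eq_zero, zero_div]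
    intro a ha
    have := Finset.mem_range.1 ha
    exact hN _ _ (by omega)
  calc J 0 0 = lavg J 0 - lavg J N := by rw [h0, h1, sub_zero]
    _ = ∑ n ∈ Finset.range N, (lavg J n - lavg J (n+1)) := (Finset.sum_range_sub' _ _).symm
    _ ≤ _ := Finset.sum_le_sum (fun n _ => lavg_step J n)

lemma sum_inj_le {ι κ : Type*} [DecidableEq κ] (s : Finset ι) (E : ι → κ) (hE : Set.InjOn E s) (w : κ → ℝ)
    (hw : ∀ e, 0 ≤ w e) (B : Finset κ) :
    ∑ i ∈ s, (if E i ∈ B then w (E i) else 0) ≤ ∑ e ∈ B, w e := by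
  rw [← Finset.sum_filter, ← Finset.sum_image (f := w) (g := E)
    (fun a ha b hb => hE (Finset.mem_filter.1 ha).1 (Finset.mem_filter.1 hb).1)]
  apply Finset.sum_le_sum_of_subset_of_nonneg
  · intro e he
    obtain ⟨i, hi, rfl⟩ := Finset.mem_image.1 he
    exact (Finset.mem_filter.1 hi).2
  · intro e _ _; exact hw e

def qx (x0 : Site) (n a : ℕ) : Site := (x0.1 + (a:ℤ), x0.2 + ((n:ℤ) - (a:ℤ)))
def qy (x0 : Site) (n a : ℕ) (t : Bool) : Site :=
  if t then ((qx x0 n a).1 + 1, (qx x0 n a).2) else ((qx x0 n a).1, (qx x0 n a).2 + 1)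
def qe (x0 : Site) (n a : ℕ) (t u : Bool) : Site × Site :=
  if u then (qx x0 n a, qy x0 n a t) else (qy x0 n a t, qx x0 n a)

lemma flow_set (x0 : Site) (U : Finset Site) (hx : x0 ∈ U) (N : ℕ)
    (hN : ∀ a b : ℕ, a + b = N → (x0.1 + (a:ℤ), x0.2 + (b:ℤ)) ∉ U) :
    1 ≤ ∑ n ∈ Finset.range N, 1/((n:ℝ)+1) * ∑ a ∈ Finset.range (n+1),
      ∑ t : Bool, ∑ u : Bool, (if qe x0 n a t u ∈ bdry U then (1:ℝ) else 0) := by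
  have h := flow (fun a b => if (x0.1 + (a:ℤ), x0.2 + (b:ℤ)) ∈ U then 1 else 0) N
    (fun a b hab => if_neg (hN a b hab))
  simp only [Nat.cast_zero, add_zero, Prod.mk.eta, if_pos hx] at h
  refine h.trans ?_
  apply Finset.sum_le_sum
  intro n _
  apply mul_le_mul_of_nonneg_left _ (by positivity)
  apply Finset.sum_le_sum
  intro a ha
  have ha := Finset.mem_range.1 ha
  have hc : ((n - a : ℕ) : ℤ) = (n:ℤ) - a := by push_cast [show a ≤ n by omega]; ring
  have a1 : adjP (qx x0 n a) (qy x0 n a true) := adjP_of_cases (by simp [qy])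
  have a2 : adjP (qx x0 n a) (qy x0 n a false) := adjP_of_cases (by simp [qy])
  have b1 := adjP_comm.1 a1
  have b2 := adjP_comm.1 a2
  have e0 : (x0.1 + (a:ℤ), x0.2 + ((n - a : ℕ):ℤ)) = qx x0 n a := by simp [qx, hc]
  have e1 : (x0.1 + ((a+1:ℕ):ℤ), x0.2 + ((n - a : ℕ):ℤ)) = qy x0 n a true := by
    simp [qx, qy, hc]; ring
  have e2 : (x0.1 + (a:ℤ), x0.2 + ((n - a + 1: ℕ):ℤ)) = qy x0 n a false := by
    push_cast [-Nat.cast_sub]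
    rw [hc]; simp [qx, qy]; ring
  rw [e0, e1, e2]
  simp only [Fintype.sum_bool, qe, mem_bdry, if_true, a1, a2, b1, b2, true_and]
  by_cases u1 : qx x0 n a ∈ U <;> by_cases u2 : qy x0 n a true ∈ U <;>
    by_cases u3 : qy x0 n a false ∈ U <;> simp [u1, u2, u3, a1, a2, b1, b2]


def epsP (p : ℝ) : ℝ := ((1 - 1/(p-1))/12) ^ (p-1)

lemma alpha_pos {p : ℝ} (hp : 2 < p) : 0 < 1/(p-1) ∧ 1/(p-1) < 1 := by
  constructor
  · apply div_pos one_pos; linarith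
  · rw [div_lt_one (by linarith)]; linarith

lemma epsP_pos {p : ℝ} (hp : 2 < p) : 0 < epsP p := by
  have := alpha_pos hp
  apply Real.rpow_pos_of_pos
  linarith

lemma epsP_le {p : ℝ} (hp : 2 < p) : epsP p ≤ 1 := by
  have := alpha_pos hp
  apply Real.rpow_le_one <;> linarith

lemma epsP_rpow {p : ℝ} (hp : 2 < p) : (epsP p) ^ (1/(p-1)) = (1 - 1/(p-1))/12 := by
  have := alpha_pos hp
  unfold epsP
  rw [← Real.rpow_mul (by linarith), mul_one_div_cancel (by linarith), Real.rpow_one]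

def thr (p : ℝ) (h n : ℕ) : ℝ := (epsP p * h / ((n:ℝ)+1)) ^ (1/(p-1))

lemma thr_pos {p : ℝ} (hp : 2 < p) {h : ℕ} (hh : 1 ≤ h) (n : ℕ) : 0 < thr p h n := by
  have := epsP_pos hp
  have : (0:ℝ) < h := by exact_mod_cast hh
  unfold thr
  positivity

lemma thr_rpow {p : ℝ} (hp : 2 < p) {h : ℕ} (n : ℕ) :
    (thr p h n) ^ (p-1) = epsP p * h / ((n:ℝ)+1) := by
  have := epsP_pos hp
  unfold thr
  rw [← Real.rpow_mul (by positivity), one_div_mul_cancel (by linarith), Real.rpow_one]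

lemma thr_sum {p : ℝ} (hp : 2 < p) {h : ℕ} (hh : 1 ≤ h) :
    ∑ n ∈ Finset.range (2*h+1), 2 * thr p h n ≤ (h:ℝ)/2 := by
  have h0 := epsP_pos hp
  obtain ⟨a0, a1⟩ := alpha_pos hp
  have hh' : (1:ℝ) ≤ h := by exact_mod_cast hh
  set α := 1/(p-1) with hα
  have e1 : ∀ n : ℕ, thr p h n = (1-α)/12 * (h:ℝ)^α * ((n:ℝ)+1)^(-α) := by
    intro n
    unfold thr
    rw [← hα, Real.div_rpow (by positivity) (by positivity), Real.mul_rpow h0.le (by positivity),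
      hα, epsP_rpow hp, ← hα, Real.rpow_neg (by positivity), div_eq_mul_inv]
  simp_rw [e1]
  rw [← Finset.mul_sum, ← Finset.mul_sum]
  have h2 := sum_rpow_bound α a0 a1 (2*h+1)
  have h3 : (((2*h+1:ℕ):ℝ)) ^ (1-α) ≤ 3 * (h:ℝ)^(1-α) := by
    calc (((2*h+1:ℕ):ℝ)) ^ (1-α) ≤ (3 * (h:ℝ)) ^ (1-α) := by
          apply Real.rpow_le_rpow (by positivity) _ (by linarith)
          push_cast; linarith
      _ = 3 ^ (1-α) * (h:ℝ)^(1-α) := Real.mul_rpow (by norm_num) (by positivity)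
      _ ≤ 3 * (h:ℝ)^(1-α) := by
          gcongr
          calc (3:ℝ)^(1-α) ≤ 3 ^ (1:ℝ) := Real.rpow_le_rpow_of_exponent_le (by norm_num) (by linarith)
            _ = 3 := Real.rpow_one 3
  have hpos : 0 < 1 - α := by linarith
  have e4 : (h:ℝ)^α * (h:ℝ)^(1-α) = h := by
    rw [← Real.rpow_add (by linarith)]; simp
  calc 2 * ((1-α)/12 * (h:ℝ)^α * ∑ n ∈ Finset.range (2*h+1), ((n:ℝ)+1)^(-α))
      ≤ 2 * ((1-α)/12 * (h:ℝ)^α * (3 * (h:ℝ)^(1-α) / (1-α))) := by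
        gcongr
        exact h2.trans (by gcongr)
    _ = (h:ℝ)^α * (h:ℝ)^(1-α) / 2 := by field_simp; norm_num
    _ = h/2 := by rw [e4]

lemma qe_inj (x0 : Site) {n a n' a' : ℕ} {t u t' u' : Bool}
    (h : qe x0 n a t u = qe x0 n' a' t' u') : n = n' ∧ a = a' ∧ t = t' ∧ u = u' := by
  cases t <;> cases u <;> cases t' <;> cases u' <;>
    simp [qe, qy, qx] at h <;> (try simp only [and_true, true_and]) <;> omega

def dw (η : Site → ℤ) (p : ℝ) (e : Site × Site) : ℝ := ((|η e.1 - η e.2| : ℤ) : ℝ) ^ (p-1)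

lemma qsum_le (x0 : Site) (N : ℕ) (w : Site × Site → ℝ) (hw : ∀ e, 0 ≤ w e) (B : Finset (Site × Site)) :
    ∑ n ∈ Finset.range N, ∑ a ∈ Finset.range (n+1), ∑ t : Bool,
        ∑ u : Bool, (if qe x0 n a t u ∈ B then w (qe x0 n a t u) else 0) ≤
        ∑ e ∈ B, w e := by
  have := sum_inj_le ((((Finset.range N).sigma fun n => Finset.range (n+1)) ×ˢ
        (Finset.univ : Finset Bool)) ×ˢ (Finset.univ : Finset Bool))
        (fun i => qe x0 i.1.1.1 i.1.1.2 i.1.2 i.2) (by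
          rintro ⟨⟨⟨n,a⟩,t⟩,u⟩ _ ⟨⟨⟨n',a'⟩,t'⟩,u'⟩ _ hab
          obtain ⟨rfl, rfl, rfl, rfl⟩ := qe_inj x0 hab
          rfl) w hw B
  refine le_trans (le_of_eq ?_) this
  rw [Finset.sum_product, Finset.sum_product, Finset.sum_sigma]

set_option maxHeartbeats 1000000 in
lemma exists_drop {p : ℝ} (hp : 2 < p) (η : Site → ℤ) (x0 : Site) (h : ℕ) (hh : 1 ≤ h)
    (U : ℕ → Finset Site) (hx : ∀ j ∈ Finset.Icc 1 h, x0 ∈ U j)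
    (hG : ∀ j ∈ Finset.Icc 1 h, Good (U j))
    (hc : ∀ j ∈ Finset.Icc 1 h, (bdry (U j)).card ≤ h)
    (hη : ∀ j ∈ Finset.Icc 1 h, ∀ e ∈ bdry (U j), η e.2 < (j:ℤ) ∧ (j:ℤ) ≤ η e.1) :
    ∃ j ∈ Finset.Icc 1 h, epsP p / 2 * h ≤ ∑ e ∈ bdry (U j), dw η p e := by
  have hh' : (1:ℝ) ≤ h := by exact_mod_cast hh
  have hε := epsP_pos hp
  by_contra hcon
  push Not at hcon
  set N := 2*h+1 with hN
  set K := epsP p * h with hK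
  have hKpos : 0 < K := by positivity
  -- multiplicities
  let M : ℕ → ℕ → Bool → ℝ := fun n a t =>
    ∑ j ∈ Finset.Icc 1 h, ∑ u : Bool, (if qe x0 n a t u ∈ bdry (U j) then (1:ℝ) else 0)
  let d : ℕ → ℕ → Bool → ℝ := fun n a t => ((|η (qx x0 n a) - η (qy x0 n a t)| : ℤ) : ℝ)
  have hd0 : ∀ n a t, 0 ≤ d n a t := fun n a t => by
    simp only [d]; exact_mod_cast abs_nonneg _
  have hM0 : ∀ n a t, 0 ≤ M n a t := fun n a t =>
    Finset.sum_nonneg fun j _ => Finset.sum_nonneg fun u _ => by split_ifs <;> norm_num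
  have hMd : ∀ n a t, M n a t ≤ d n a t := by
    intro n a t
    set lo := min (η (qx x0 n a)) (η (qy x0 n a t)) with hlo
    set hi := max (η (qx x0 n a)) (η (qy x0 n a t)) with hhi
    have h1 : ∀ j ∈ Finset.Icc 1 h, (∑ u : Bool, (if qe x0 n a t u ∈ bdry (U j) then (1:ℝ) else 0)) ≤
        if (j:ℤ) ∈ Finset.Ioc lo hi then 1 else 0 := by
      intro j hj
      simp only [Fintype.sum_bool, qe, if_true, Finset.mem_Ioc]
      have k1 := hη j hj (qx x0 n a, qy x0 n a t)
      have k2 := hη j hj (qy x0 n a t, qx x0 n a)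
      simp only at k1 k2
      by_cases m1 : (qx x0 n a, qy x0 n a t) ∈ bdry (U j)
      · have m2 : (qy x0 n a t, qx x0 n a) ∉ bdry (U j) := by
          intro m2; have := k1 m1; have := k2 m2; omega
        have := k1 m1
        have hin : lo < (j:ℤ) ∧ (j:ℤ) ≤ hi := by omega
        simp [m1, m2, hin]
      · by_cases m2 : (qy x0 n a t, qx x0 n a) ∈ bdry (U j)
        · have := k2 m2
          have hin : lo < (j:ℤ) ∧ (j:ℤ) ≤ hi := by omega
          simp [m1, m2, hin]
        · simp [m1, m2]; split_ifs <;> norm_num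
    have h2 : M n a t ≤ ∑ j ∈ Finset.Icc 1 h, if (j:ℤ) ∈ Finset.Ioc lo hi then (1:ℝ) else 0 :=
      Finset.sum_le_sum h1
    have h3 := sum_inj_le (Finset.Icc 1 h) (fun j : ℕ => (j:ℤ)) (fun a _ b _ hab => by simpa using hab)
      (fun _ => (1:ℝ)) (fun _ => by norm_num) (Finset.Ioc lo hi)
    refine (h2.trans h3).trans ?_
    simp only [Finset.sum_const, Int.card_Ioc, nsmul_eq_mul, mul_one, d]
    have : ((hi - lo).toNat : ℤ) = |η (qx x0 n a) - η (qy x0 n a t)| := by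
      rcases abs_cases (η (qx x0 n a) - η (qy x0 n a t)) with h | h <;> omega
    rw [← this]
    push_cast
    exact le_rfl
  -- pointwise
  have hpt : ∀ n a t, M n a t ≤ thr p h n + M n a t * (d n a t) ^ (p-1) * (((n:ℝ)+1) / K) := by
    intro n a t
    have ht := thr_pos hp hh n
    have hr : 0 ≤ M n a t * (d n a t) ^ (p-1) * (((n:ℝ)+1) / K) := by
      have := hM0 n a t
      have := Real.rpow_nonneg (hd0 n a t) (p-1)
      positivity
    by_cases hle : d n a t ≤ thr p h n
    · linarith [hMd n a t]
    · push Not at hle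
      have h1 : K / ((n:ℝ)+1) ≤ (d n a t) ^ (p-1) := by
        rw [hK, ← thr_rpow hp n]
        apply Real.rpow_le_rpow ht.le hle.le (by linarith)
      have h2 : 1 ≤ (d n a t) ^ (p-1) * (((n:ℝ)+1) / K) := by
        rw [div_le_iff₀ (by positivity)] at h1
        rw [← mul_div_assoc, le_div_iff₀ hKpos]; linarith
      have h3 : M n a t ≤ M n a t * ((d n a t) ^ (p-1) * (((n:ℝ)+1) / K)) :=
        le_mul_of_one_le_right (hM0 n a t) h2
      rw [← mul_assoc] at h3
      linarith
  -- total
  have htot : (h:ℝ) ≤ ∑ n ∈ Finset.range N, 1/((n:ℝ)+1) * ∑ a ∈ Finset.range (n+1), ∑ t : Bool, M n a t := by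
    have h1 : ∀ j ∈ Finset.Icc 1 h, (1:ℝ) ≤ ∑ n ∈ Finset.range N, 1/((n:ℝ)+1) * ∑ a ∈ Finset.range (n+1),
      ∑ t : Bool, ∑ u : Bool, (if qe x0 n a t u ∈ bdry (U j) then (1:ℝ) else 0) := by
      intro j hj
      apply flow_set x0 (U j) (hx j hj)
      intro a b hab hm
      have := (hG j hj).box (hx j hj) hm
      have := hc j hj
      simp only at *
      omega
    have h2 := Finset.sum_le_sum h1
    simp only [Finset.sum_const, Nat.card_Icc, nsmul_eq_mul, mul_one, Nat.add_sub_cancel] at h2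
    refine h2.trans (le_of_eq ?_)
    rw [Finset.sum_comm]
    apply Finset.sum_congr rfl
    intro n _
    rw [← Finset.mul_sum]
    congr 1
    rw [Finset.sum_comm]
    apply Finset.sum_congr rfl
    intro a _
    rw [Finset.sum_comm]
  have hlast : ∑ n ∈ Finset.range N, ∑ a ∈ Finset.range (n+1), ∑ t : Bool, M n a t * (d n a t) ^ (p-1)
      ≤ ∑ j ∈ Finset.Icc 1 h, ∑ e ∈ bdry (U j), dw η p e := by
    have h1 : ∀ j ∈ Finset.Icc 1 h, ∑ n ∈ Finset.range N, ∑ a ∈ Finset.range (n+1), ∑ t : Bool,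
        ∑ u : Bool, (if qe x0 n a t u ∈ bdry (U j) then dw η p (qe x0 n a t u) else 0) ≤
        ∑ e ∈ bdry (U j), dw η p e := by
      intro j _
      exact qsum_le x0 N (dw η p) (fun e => Real.rpow_nonneg (by exact_mod_cast abs_nonneg _) _) (bdry (U j))
    refine le_trans (le_of_eq ?_) (Finset.sum_le_sum h1)
    symm
    rw [Finset.sum_comm]
    apply Finset.sum_congr rfl
    intro n _
    rw [Finset.sum_comm]
    apply Finset.sum_congr rfl
    intro a _
    rw [Finset.sum_comm]
    apply Finset.sum_congr rfl
    intro t _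
    simp only [M]
    rw [Finset.sum_mul]
    apply Finset.sum_congr rfl
    intro j _
    rw [Finset.sum_mul]
    apply Finset.sum_congr rfl
    intro u _
    have : dw η p (qe x0 n a t u) = d n a t ^ (p-1) := by
      cases u
      · simp only [dw, qe, d]; rw [abs_sub_comm]; simp
      · simp only [dw, qe, d]; simp
    rw [this]
    split_ifs <;> simp
  have hfin : (h:ℝ) ≤ h/2 + 1/K * ∑ j ∈ Finset.Icc 1 h, ∑ e ∈ bdry (U j), dw η p e := by
    calc (h:ℝ) ≤ _ := htot
      _ ≤ ∑ n ∈ Finset.range N, 1/((n:ℝ)+1) * ∑ a ∈ Finset.range (n+1), ∑ t : Bool,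
          (thr p h n + M n a t * (d n a t) ^ (p-1) * (((n:ℝ)+1) / K)) := by
          gcongr
          exact hpt _ _ _
      _ = ∑ n ∈ Finset.range N, 2 * thr p h n + 1/K * ∑ n ∈ Finset.range N,
          ∑ a ∈ Finset.range (n+1), ∑ t : Bool, M n a t * (d n a t) ^ (p-1) := by
          rw [Finset.mul_sum, ← Finset.sum_add_distrib]
          apply Finset.sum_congr rfl
          intro n _
          simp_rw [Finset.sum_add_distrib, ← Finset.sum_mul]
          simp only [Finset.sum_const, Finset.card_univ, Fintype.card_bool, Finset.card_range,
            nsmul_eq_mul]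
          push_cast
          field_simp
      _ ≤ _ := by
          gcongr
          exact thr_sum hp hh
  have hsum : ∑ j ∈ Finset.Icc 1 h, ∑ e ∈ bdry (U j), dw η p e < ∑ j ∈ Finset.Icc 1 h, epsP p / 2 * h :=
    Finset.sum_lt_sum_of_nonempty ⟨1, Finset.mem_Icc.2 ⟨le_rfl, hh⟩⟩ hcon
  simp only [Finset.sum_const, Nat.card_Icc, nsmul_eq_mul, Nat.add_sub_cancel] at hsum
  have : 1/K * ∑ j ∈ Finset.Icc 1 h, ∑ e ∈ bdry (U j), dw η p e < 1/K * (h * (epsP p / 2 * h)) := by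
    gcongr
  have e5 : 1/K * (h * (epsP p / 2 * h)) = h/2 := by rw [hK]; field_simp
  linarith

def RowConv (Λ : Finset Site) : Prop :=
  ∀ a b c y : ℤ, (a,y) ∈ Λ → (b,y) ∈ Λ → a ≤ c → c ≤ b → (c,y) ∈ Λ

lemma ball_rowConv (L : ℕ) : RowConv (ball L) := by
  intro a b c y ha hb hac hcb
  simp only [ball, Int.ceil_natCast, Finset.mem_filter, Finset.mem_product, Finset.mem_Icc] at *
  obtain ⟨⟨⟨a1,a2⟩,a3,a4⟩,a5⟩ := ha
  obtain ⟨⟨⟨b1,b2⟩,b3,b4⟩,b5⟩ := hb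
  refine ⟨⟨⟨by omega, by omega⟩, by omega, by omega⟩, ?_⟩
  have h1 : (a:ℝ) ≤ c := by exact_mod_cast hac
  have h2 : (c:ℝ) ≤ b := by exact_mod_cast hcb
  rcases le_total (0:ℝ) (c:ℝ) with h | h <;> nlinarith

lemma dw_ge_one {η : Site → ℤ} {p : ℝ} (hp : 2 < p) {e : Site × Site} (h : η e.2 < η e.1) :
    1 ≤ dw η p e := by
  unfold dw
  apply Real.one_le_rpow _ (by linarith)
  have : 1 ≤ |η e.1 - η e.2| := by rw [abs_of_pos (by omega)]; omega
  exact_mod_cast this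

lemma dw_nonneg (η : Site → ℤ) (p : ℝ) (e : Site × Site) : 0 ≤ dw η p e :=
  Real.rpow_nonneg (by exact_mod_cast abs_nonneg _) _

lemma drop_config {p : ℝ} (hp : 2 < p) (Λ : Finset Site) (hΛ : RowConv Λ) (η : Site → ℤ)
    (h0 : ∀ x ∉ Λ, η x = 0) (x0 : Site) (h : ℕ) (hh : 1 ≤ h) (hx : η x0 = h) :
    ∃ U ⊆ Λ, x0 ∈ U ∧ Good U ∧ (∀ e ∈ bdry U, η e.2 < η e.1) ∧
      epsP p / 2 * h ≤ ∑ e ∈ bdry U, dw η p e ∧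
      ((bdry U).card : ℝ) ≤ ∑ e ∈ bdry U, dw η p e := by
  have hh' : (1:ℝ) ≤ h := by exact_mod_cast hh
  have hx0 : x0 ∈ Λ := by
    by_contra hn; have := h0 x0 hn; omega
  have H : ∀ j ∈ Finset.Icc 1 h, ∃ U, U ⊆ Λ ∧ x0 ∈ U ∧ Good U ∧
      ∀ e ∈ bdry U, η e.2 < (j:ℤ) ∧ (j:ℤ) ≤ η e.1 := by
    intro j hj
    obtain ⟨j1, j2⟩ := Finset.mem_Icc.1 hj
    obtain ⟨U, hU, hb, hg⟩ := exists_good (Λ.filter (fun x => (j:ℤ) ≤ η x)) x0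
      (Finset.mem_filter.2 ⟨hx0, by omega⟩)
    refine ⟨U, ?_, hU, hg, ?_⟩
    · intro x hxU
      obtain ⟨k, hk⟩ := exit_right hxU
      obtain ⟨l, hl⟩ := exit_left hxU
      have hk := (mem_bdry.1 (hb hk)).2.1
      have hl := (mem_bdry.1 (hb hl)).2.1
      exact hΛ _ _ x.1 x.2 (Finset.mem_filter.1 hl).1 (Finset.mem_filter.1 hk).1 (by omega) (by omega)
    · intro e he
      obtain ⟨_, h1, h2⟩ := mem_bdry.1 (hb he)
      refine ⟨?_, (Finset.mem_filter.1 h1).2⟩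
      by_contra hc
      push Not at hc
      apply h2
      refine Finset.mem_filter.2 ⟨?_, hc⟩
      by_contra hn; have := h0 _ hn; omega
  choose! U hUΛ hUx hUG hUη using H
  have hcard : ∀ j ∈ Finset.Icc 1 h, ((bdry (U j)).card : ℝ) ≤ ∑ e ∈ bdry (U j), dw η p e := by
    intro j hj
    have := Finset.card_nsmul_le_sum (bdry (U j)) (dw η p) 1
      (fun e he => dw_ge_one hp (by have := hUη j hj e he; omega))
    simpa using this
  have fin : ∀ j ∈ Finset.Icc 1 h, epsP p / 2 * h ≤ ∑ e ∈ bdry (U j), dw η p e → _ :=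
    fun j hj hs => (⟨U j, hUΛ j hj, hUx j hj, hUG j hj,
      (fun e he => by have := hUη j hj e he; omega), hs, hcard j hj⟩ :
      ∃ U ⊆ Λ, x0 ∈ U ∧ Good U ∧ (∀ e ∈ bdry U, η e.2 < η e.1) ∧
      epsP p / 2 * h ≤ ∑ e ∈ bdry U, dw η p e ∧
      ((bdry U).card : ℝ) ≤ ∑ e ∈ bdry U, dw η p e)
  by_cases hc : ∀ j ∈ Finset.Icc 1 h, (bdry (U j)).card ≤ h
  · obtain ⟨j, hj, hs⟩ := exists_drop hp η x0 h hh U hUx hUG hc hUη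
    exact fin j hj hs
  · push Not at hc
    obtain ⟨j, hj, hs⟩ := hc
    refine fin j hj ?_
    have := hcard j hj
    have h3 : (h:ℝ) ≤ (bdry (U j)).card := by exact_mod_cast hs.le
    have := epsP_le hp
    nlinarith

def hterm (p : ℝ) (η : Site → ℤ) (e : Site × Site) : ℝ :=
  if adjP e.1 e.2 then ((|η e.1 - η e.2| : ℤ) : ℝ) ^ p else 0

lemma pH_def (p : ℝ) (η : Site → ℤ) : pH p η = (1/2) * ∑' e, hterm p η e := rfl

lemma hterm_nonneg (p : ℝ) (η : Site → ℤ) (e : Site × Site) : 0 ≤ hterm p η e := by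
  unfold hterm; split_ifs
  · exact Real.rpow_nonneg (by exact_mod_cast abs_nonneg _) _
  · exact le_rfl

def enl (Λ : Finset Site) : Finset Site := Λ ∪ Λ.biUnion nbrs

lemma hterm_supp {p : ℝ} (hp : 2 < p) {Λ : Finset Site} {η : Site → ℤ} (h0 : ∀ x ∉ Λ, η x = 0)
    {e : Site × Site} (he : e ∉ enl Λ ×ˢ enl Λ) : hterm p η e = 0 := by
  unfold hterm
  split_ifs with ha
  · have h1 : e.1 ∉ Λ := by
      intro h; apply he
      refine Finset.mem_product.2 ⟨Finset.mem_union_left _ h, Finset.mem_union_right _ ?_⟩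
      exact Finset.mem_biUnion.2 ⟨_, h, adjP_iff.1 ha⟩
    have h2 : e.2 ∉ Λ := by
      intro h; apply he
      refine Finset.mem_product.2 ⟨Finset.mem_union_right _ ?_, Finset.mem_union_left _ h⟩
      exact Finset.mem_biUnion.2 ⟨_, h, adjP_iff.1 (adjP_comm.1 ha)⟩
    rw [h0 _ h1, h0 _ h2]
    simp
    rw [Real.zero_rpow (by linarith)]
  · rfl

lemma hterm_summable {p : ℝ} (hp : 2 < p) {Λ : Finset Site} {η : Site → ℤ} (h0 : ∀ x ∉ Λ, η x = 0) :
    Summable (hterm p η) :=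
  summable_of_ne_finset_zero (s := enl Λ ×ˢ enl Λ) (fun _ he => hterm_supp hp h0 he)

lemma pH_eq {p : ℝ} (hp : 2 < p) {Λ : Finset Site} {η : Site → ℤ} (h0 : ∀ x ∉ Λ, η x = 0) :
    pH p η = (1/2) * ∑ e ∈ enl Λ ×ˢ enl Λ, hterm p η e := by
  rw [pH_def, tsum_eq_sum (s := enl Λ ×ˢ enl Λ) (fun _ he => hterm_supp hp h0 he)]

lemma pH_nonneg (p : ℝ) (η : Site → ℤ) : 0 ≤ pH p η := by
  rw [pH_def]
  have : 0 ≤ ∑' e, hterm p η e := tsum_nonneg (hterm_nonneg p η)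
  positivity

lemma rpow_drop {p : ℝ} (hp : 2 < p) {d : ℝ} (hd : 1 ≤ d) : d^(p-1) + (d-1)^p ≤ d^p := by
  have e1 : d^p = d * d^(p-1) := by
    rw [← Real.rpow_one_add' (by linarith) (by linarith)]; congr 1; ring
  have e2 : (d-1)^p = (d-1) * (d-1)^(p-1) := by
    rw [← Real.rpow_one_add' (by linarith) (by linarith)]; congr 1; ring
  have e3 : (d-1)^(p-1) ≤ d^(p-1) := Real.rpow_le_rpow (by linarith) (by linarith) (by linarith)
  have : 0 ≤ d - 1 := by linarith
  nlinarith

def shift (U : Finset Site) (η : Site → ℤ) : Site → ℤ := fun x => η x - if x ∈ U then 1 else 0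

lemma dw_swap (η : Site → ℤ) (p : ℝ) (e : Site × Site) : dw η p e.swap = dw η p e := by
  simp [dw, abs_sub_comm]

lemma hterm_swap (p : ℝ) (η : Site → ℤ) (e : Site × Site) : hterm p η e.swap = hterm p η e := by
  simp [hterm, abs_sub_comm, adjP_comm (x := e.2)]

lemma hterm_drop_aux {p : ℝ} (hp : 2 < p) (U : Finset Site) (η : Site → ℤ)
    (hη : ∀ e ∈ bdry U, η e.2 < η e.1) (e : Site × Site) (he : e ∈ bdry U) :
    dw η p e + hterm p (shift U η) e ≤ hterm p η e := by
  obtain ⟨h1, h2, h3⟩ := mem_bdry.1 he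
  have h4 := hη e he
  simp only [hterm, if_pos h1, dw, shift, if_pos h2, if_neg h3]
  rw [abs_of_nonneg (by omega : 0 ≤ η e.1 - η e.2), abs_of_nonneg (by omega)]
  have h5 : (1:ℝ) ≤ ((η e.1 - η e.2 : ℤ):ℝ) := by exact_mod_cast (by omega : 1 ≤ η e.1 - η e.2)
  have := rpow_drop hp h5
  refine le_trans (le_of_eq ?_) this
  congr 2
  push_cast; ring

lemma bdry_not_swap {U : Finset Site} {e : Site × Site} (he : e ∈ bdry U) : e.swap ∉ bdry U := by
  intro h
  exact (mem_bdry.1 he).2.2 (mem_bdry.1 h).2.1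

lemma hterm_drop {p : ℝ} (hp : 2 < p) (U : Finset Site) (η : Site → ℤ)
    (hη : ∀ e ∈ bdry U, η e.2 < η e.1) (e : Site × Site) :
    (if e ∈ bdry U then dw η p e else 0) + (if e.swap ∈ bdry U then dw η p e.swap else 0)
      + hterm p (shift U η) e ≤ hterm p η e := by
  by_cases h1 : e ∈ bdry U
  · rw [if_pos h1, if_neg (bdry_not_swap h1), add_zero]
    exact hterm_drop_aux hp U η hη e h1
  · by_cases h2 : e.swap ∈ bdry U
    · rw [if_neg h1, if_pos h2, zero_add]
      have := hterm_drop_aux hp U η hη e.swap h2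
      rwa [hterm_swap, hterm_swap] at this
    · rw [if_neg h1, if_neg h2]
      simp only [add_zero, zero_add]
      by_cases ha : adjP e.1 e.2
      · have hiff : e.1 ∈ U ↔ e.2 ∈ U := by
          constructor
          · intro h; by_contra h'; exact h1 (mem_bdry.2 ⟨ha, h, h'⟩)
          · intro h; by_contra h'; exact h2 (mem_bdry.2 ⟨adjP_comm.1 ha, h, h'⟩)
        apply le_of_eq
        simp only [hterm, shift, hiff]
        simp
      · simp [hterm, ha]

lemma shift_supp {U Λ : Finset Site} (hU : U ⊆ Λ) {η : Site → ℤ} (h0 : ∀ x ∉ Λ, η x = 0) :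
    ∀ x ∉ Λ, shift U η x = 0 := by
  intro x hx
  have : x ∉ U := fun h => hx (hU h)
  simp [shift, h0 x hx, this]

lemma pH_drop {p : ℝ} (hp : 2 < p) {Λ U : Finset Site} (hU : U ⊆ Λ) {η : Site → ℤ}
    (h0 : ∀ x ∉ Λ, η x = 0) (hη : ∀ e ∈ bdry U, η e.2 < η e.1) :
    pH p (shift U η) + ∑ e ∈ bdry U, dw η p e ≤ pH p η := by
  have hb : ∀ e ∈ bdry U, e.1 ∈ enl Λ ∧ e.2 ∈ enl Λ := by
    intro e he
    obtain ⟨h1, h2, h3⟩ := mem_bdry.1 he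
    exact ⟨Finset.mem_union_left _ (hU h2), Finset.mem_union_right _
      (Finset.mem_biUnion.2 ⟨_, hU h2, adjP_iff.1 h1⟩)⟩
  rw [pH_eq hp h0, pH_eq hp (shift_supp hU h0)]
  have h1 := Finset.sum_le_sum (s := enl Λ ×ˢ enl Λ) (fun e _ => hterm_drop hp U η hη e)
  rw [Finset.sum_add_distrib, Finset.sum_add_distrib] at h1
  have e1 : ∑ e ∈ enl Λ ×ˢ enl Λ, (if e ∈ bdry U then dw η p e else 0) = ∑ e ∈ bdry U, dw η p e := by
    rw [Finset.sum_ite_mem]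
    congr 1
    rw [Finset.inter_eq_right]
    intro e he
    exact Finset.mem_product.2 (hb e he)
  have e2 : ∑ e ∈ enl Λ ×ˢ enl Λ, (if e.swap ∈ bdry U then dw η p e.swap else 0)
      = ∑ e ∈ bdry U, dw η p e := by
    rw [← e1, Finset.sum_product_right, Finset.sum_product]
    rfl
  rw [e1, e2] at h1
  linarith

lemma int_le_rpow {p : ℝ} (hp : 2 < p) (k : ℤ) : ((|k| : ℤ) : ℝ) ≤ ((|k| : ℤ) : ℝ) ^ p := by
  rcases eq_or_ne k 0 with rfl | hk
  · simp; exact Real.rpow_nonneg le_rfl p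
  · have : (1:ℝ) ≤ ((|k| : ℤ) : ℝ) := by exact_mod_cast Int.one_le_abs hk
    calc ((|k| : ℤ) : ℝ) = ((|k| : ℤ) : ℝ) ^ (1:ℝ) := (Real.rpow_one _).symm
      _ ≤ _ := Real.rpow_le_rpow_of_exponent_le this (by linarith)

lemma abs_le_pH {p : ℝ} (hp : 2 < p) {Λ : Finset Site} {η : Site → ℤ} (h0 : ∀ x ∉ Λ, η x = 0)
    (x : Site) : ((|η x| : ℤ) : ℝ) ≤ 2 * pH p η := by
  by_cases hx : x ∈ Λ
  swap
  · rw [h0 x hx]; simpa using pH_nonneg p η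
  obtain ⟨k, hk⟩ := exit_right hx
  have hk := (mem_bdry.1 hk).2.2
  let E : ℕ → Site × Site := fun i => ((x.1 + (i:ℤ), x.2), (x.1 + (i:ℤ) + 1, x.2))
  have hE : Function.Injective E := by
    intro i j hij
    simp only [E, Prod.mk.injEq] at hij
    omega
  have hs := hterm_summable hp h0
  have h1 : ∑ i ∈ Finset.range (k+1), hterm p η (E i) ≤ ∑' e, hterm p η e := by
    rw [← Finset.sum_image (f := hterm p η) (g := E) (fun a _ b _ h => hE h)]
    exact hs.sum_le_tsum _ (fun e _ => hterm_nonneg p η e)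
  have h2 : ∀ n : ℕ, ((|η x| : ℤ):ℝ) ≤ ∑ i ∈ Finset.range n, hterm p η (E i)
      + ((|η (x.1 + (n:ℤ), x.2)| : ℤ):ℝ) := by
    intro n
    induction n with
    | zero => simp
    | succ n ih =>
      rw [Finset.sum_range_succ]
      have ha : adjP (E n).1 (E n).2 := adjP_of_cases (by simp [E])
      have h3 : ((|η (x.1 + (n:ℤ), x.2) - η (x.1 + (n:ℤ) + 1, x.2)| : ℤ):ℝ) ≤ hterm p η (E n) := by
        rw [hterm, if_pos ha]
        exact int_le_rpow hp _
      have h4 : |η (x.1 + (n:ℤ), x.2)| ≤ |η (x.1 + (n:ℤ), x.2) - η (x.1 + (n:ℤ) + 1, x.2)| +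
          |η (x.1 + (n:ℤ) + 1, x.2)| := by
        have := abs_add_le (η (x.1 + (n:ℤ), x.2) - η (x.1 + (n:ℤ) + 1, x.2)) (η (x.1 + (n:ℤ) + 1, x.2))
        simpa using this
      have h5 : ((|η (x.1 + (n:ℤ), x.2)| : ℤ):ℝ) ≤ ((|η (x.1 + (n:ℤ), x.2) - η (x.1 + (n:ℤ) + 1, x.2)| : ℤ):ℝ) +
          ((|η (x.1 + (n:ℤ) + 1, x.2)| : ℤ) : ℝ) := by exact_mod_cast h4
      have e6 : x.1 + (((n+1:ℕ)):ℤ) = x.1 + (n:ℤ) + 1 := by push_cast; ring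
      rw [e6]
      linarith
  have h3 := h2 (k+1)
  have e6 : x.1 + (((k+1:ℕ)):ℤ) = x.1 + (k:ℤ) + 1 := by push_cast; ring
  rw [e6, h0 _ hk] at h3
  rw [pH_def]
  simp only [abs_zero, Int.cast_zero, add_zero] at h3
  linarith

/-- weight -/
def wt (p β : ℝ) (Λ : Finset Site) (η : Site → ℤ) : ℝ :=
  if ∀ x ∉ Λ, η x = 0 then Real.exp (-β * pH p η) else 0

lemma wt_nonneg (p β : ℝ) (Λ : Finset Site) (η : Site → ℤ) : 0 ≤ wt p β Λ η := by
  unfold wt; split_ifs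
  · exact (Real.exp_pos _).le
  · exact le_rfl

lemma summable_exp_abs {b : ℝ} (hb : 0 < b) : Summable (fun k : ℤ => Real.exp (-b * ((|k| : ℤ):ℝ))) := by
  have hg : Summable (fun n : ℕ => Real.exp (-b) ^ n) :=
    summable_geometric_of_lt_one (Real.exp_pos _).le (by rw [Real.exp_lt_one_iff]; linarith)
  have e : ∀ n : ℕ, Real.exp (-b) ^ n = Real.exp (-b * n) := by
    intro n; rw [← Real.exp_nat_mul]; congr 1; ring
  simp_rw [e] at hg
  apply Summable.of_nat_of_neg
  · simpa using hg
  · simpa using hg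

lemma sum_prod_le {ι : Type*} [Fintype ι] [DecidableEq ι] (a : ℤ → ℝ) (ha : Summable a) (ha0 : ∀ k, 0 ≤ a k)
    (S : Finset (ι → ℤ)) : ∑ g ∈ S, ∏ x : ι, a (g x) ≤ ∏ _x : ι, ∑' k, a k := by
  calc ∑ g ∈ S, ∏ x : ι, a (g x)
      ≤ ∑ g ∈ Fintype.piFinset (fun x : ι => S.image (fun η => η x)), ∏ x : ι, a (g x) := by
        apply Finset.sum_le_sum_of_subset_of_nonneg
        · intro g hg
          rw [Fintype.mem_piFinset]
          intro x
          exact Finset.mem_image.2 ⟨g, hg, rfl⟩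
        · intro g _ _
          exact Finset.prod_nonneg fun x _ => ha0 _
    _ = ∏ x : ι, ∑ k ∈ S.image (fun η => η x), a k := by
        rw [Finset.prod_univ_sum]
    _ ≤ ∏ x : ι, ∑' k, a k := by
        apply Finset.prod_le_prod
        · intro x _; exact Finset.sum_nonneg fun k _ => ha0 k
        · intro x _; exact ha.sum_le_tsum _ (fun k _ => ha0 k)

lemma wt_summable {p β : ℝ} (hp : 2 < p) (hβ : 0 < β) (Λ : Finset Site) :
    Summable (wt p β Λ) := by
  set b : ℝ := β / (2 * (Λ.card + 1)) with hb
  have hbpos : 0 < b := by positivity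
  let a : ℤ → ℝ := fun k => Real.exp (-b * ((|k| : ℤ):ℝ))
  have ha : Summable a := summable_exp_abs hbpos
  have ha0 : ∀ k, 0 ≤ a k := fun k => (Real.exp_pos _).le
  have hle : ∀ η : Site → ℤ, (∀ x ∉ Λ, η x = 0) → wt p β Λ η ≤ ∏ x : Λ, a (η x) := by
    intro η h0
    rw [wt, if_pos h0, ← Real.exp_sum]
    apply Real.exp_le_exp.2
    rw [← Finset.mul_sum]
    have h1 : ∑ x : Λ, ((|η x| : ℤ):ℝ) ≤ ∑ x : Λ, 2 * pH p η :=
      Finset.sum_le_sum (fun x _ => abs_le_pH hp h0 x)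
    simp only [Finset.sum_const, Finset.card_univ, Fintype.card_coe, nsmul_eq_mul] at h1
    have h2 : b * ∑ x : Λ, ((|η x| : ℤ):ℝ) ≤ b * ((Λ.card + 1) * (2 * pH p η)) := by
      have := pH_nonneg p η
      gcongr; linarith
    have h3 : b * ((Λ.card + 1) * (2 * pH p η)) = β * pH p η := by rw [hb]; field_simp
    linarith
  apply summable_of_sum_le (c := ∏ x : Λ, ∑' k, a k) (wt_nonneg p β Λ)
  intro S
  let S' := S.filter (fun η => ∀ x ∉ Λ, η x = 0)
  let r : (Site → ℤ) → (Λ → ℤ) := fun η x => η x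
  have hr : Set.InjOn r S' := by
    intro η h1 ξ h2 h
    have h1 := (Finset.mem_filter.1 h1).2
    have h2 := (Finset.mem_filter.1 h2).2
    ext x
    by_cases hx : x ∈ Λ
    · exact congrFun h ⟨x, hx⟩
    · rw [h1 x hx, h2 x hx]
  calc ∑ η ∈ S, wt p β Λ η = ∑ η ∈ S', wt p β Λ η := by
        symm
        apply Finset.sum_filter_of_ne
        intro η _ hne
        by_contra hc
        exact hne (by rw [wt, if_neg hc])
    _ ≤ ∑ η ∈ S', ∏ x : Λ, a (r η x) := Finset.sum_le_sum fun η hη => hle η (Finset.mem_filter.1 hη).2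
    _ = ∑ g ∈ S'.image r, ∏ x : Λ, a (g x) := by
        rw [Finset.sum_image hr]
    _ ≤ ∏ x : Λ, ∑' k, a k := sum_prod_le a ha ha0 _

def wtA (p β : ℝ) (Λ : Finset Site) (A : (Site → ℤ) → Prop) (η : Site → ℤ) : ℝ :=
  if A η then wt p β Λ η else 0

lemma wtA_pos {p β : ℝ} {Λ : Finset Site} {A : (Site → ℤ) → Prop} {η : Site → ℤ} (h : A η) :
    wtA p β Λ A η = wt p β Λ η := if_pos h

lemma wtA_neg {p β : ℝ} {Λ : Finset Site} {A : (Site → ℤ) → Prop} {η : Site → ℤ} (h : ¬ A η) :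
    wtA p β Λ A η = 0 := if_neg h

lemma wtA_nonneg (p β : ℝ) (Λ : Finset Site) (A : (Site → ℤ) → Prop) (η : Site → ℤ) :
    0 ≤ wtA p β Λ A η := by
  by_cases h : A η
  · rw [wtA_pos h]; exact wt_nonneg _ _ _ _
  · rw [wtA_neg h]

lemma wtA_le (p β : ℝ) (Λ : Finset Site) (A : (Site → ℤ) → Prop) (η : Site → ℤ) :
    wtA p β Λ A η ≤ wt p β Λ η := by
  by_cases h : A η
  · rw [wtA_pos h]
  · rw [wtA_neg h]; exact wt_nonneg _ _ _ _

lemma pW_eq (p β : ℝ) (Λ : Finset Site) (A : (Site → ℤ) → Prop) :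
    pW p β Λ A = ∑' η, wtA p β Λ A η := by
  unfold pW wtA wt
  apply tsum_congr
  intro η
  by_cases h1 : ∀ x ∉ Λ, η x = 0 <;> by_cases h2 : A η <;> simp [h1, h2]

lemma wtA_summable {p β : ℝ} (hp : 2 < p) (hβ : 0 < β) (Λ : Finset Site) (A : (Site → ℤ) → Prop) :
    Summable (wtA p β Λ A) :=
  (wt_summable hp hβ Λ).of_nonneg_of_le (wtA_nonneg p β Λ A) (wtA_le p β Λ A)

lemma pW_nonneg (p β : ℝ) (Λ : Finset Site) (A : (Site → ℤ) → Prop) : 0 ≤ pW p β Λ A := by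
  rw [pW_eq]
  exact tsum_nonneg (wtA_nonneg p β Λ A)

lemma pW_mono {p β : ℝ} (hp : 2 < p) (hβ : 0 < β) (Λ : Finset Site) {A B : (Site → ℤ) → Prop}
    (h : ∀ η, A η → B η) : pW p β Λ A ≤ pW p β Λ B := by
  rw [pW_eq, pW_eq]
  apply (wtA_summable hp hβ Λ A).tsum_le_tsum _ (wtA_summable hp hβ Λ B)
  intro η
  by_cases hA : A η
  · rw [wtA_pos hA, wtA_pos (h η hA)]
  · rw [wtA_neg hA]; exact wtA_nonneg _ _ _ _ _

lemma two_mul_le_pow (n : ℕ) : 2 * n ≤ 2 ^ n := by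
  induction n with
  | zero => simp
  | succ n ih =>
    rcases Nat.eq_zero_or_pos n with rfl | h
    · norm_num
    · rw [pow_succ]; omega

lemma geo_bound {q : ℝ} (hq : 0 ≤ q) (hq' : q ≤ 1/16) (N : ℕ) :
    ∑ n ∈ Finset.range N, ((n * 4^n : ℕ) : ℝ) * q^n ≤ 1 := by
  have h1 : ∀ n : ℕ, ((n * 4^n : ℕ) : ℝ) * q^n ≤ (1/2)^(n+1) := by
    intro n
    have h2 : (2:ℝ) * n ≤ 2^n := by exact_mod_cast two_mul_le_pow n
    have h3 : q^n ≤ (1/16)^n := pow_le_pow_left₀ hq hq' n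
    calc ((n * 4^n : ℕ) : ℝ) * q^n ≤ ((n * 4^n : ℕ) : ℝ) * (1/16)^n := by gcongr
      _ = n * (1/4)^n := by
        push_cast; rw [mul_assoc, ← mul_pow]; norm_num
      _ ≤ (2^n/2) * (1/4)^n := by gcongr; linarith
      _ = (1/2)^(n+1) := by
        rw [div_mul_eq_mul_div, ← mul_pow, pow_succ]; norm_num; ring
  have h2 : ∀ N : ℕ, ∑ n ∈ Finset.range N, (1/2:ℝ)^(n+1) = 1 - (1/2)^N := by
    intro N
    induction N with
    | zero => simp
    | succ N ih => rw [Finset.sum_range_succ, ih, pow_succ]; ring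
  calc _ ≤ ∑ n ∈ Finset.range N, (1/2:ℝ)^(n+1) := Finset.sum_le_sum fun n _ => h1 n
    _ = 1 - (1/2)^N := h2 N
    _ ≤ 1 := by have : (0:ℝ) ≤ (1/2)^N := by positivity
                linarith

lemma contour_sum {q : ℝ} (hq : 0 ≤ q) (hq' : q ≤ 1/16) (x0 : Site) (𝒰 : Finset (Finset Site))
    (h : ∀ U ∈ 𝒰, x0 ∈ U ∧ Good U) : ∑ U ∈ 𝒰, q ^ (bdry U).card ≤ 1 := by
  obtain ⟨N, hN⟩ : ∃ N, ∀ U ∈ 𝒰, (bdry U).card ∈ Finset.range N := by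
    refine ⟨𝒰.sup (fun U => (bdry U).card) + 1, fun U hU => ?_⟩
    rw [Finset.mem_range]
    exact Nat.lt_succ_of_le (Finset.le_sup (f := fun U => (bdry U).card) hU)
  rw [← Finset.sum_fiberwise_of_maps_to hN]
  refine le_trans (Finset.sum_le_sum fun n _ => ?_) (geo_bound hq hq' N)
  have : ∀ U ∈ 𝒰.filter (fun U => (bdry U).card = n), q ^ (bdry U).card = q^n := by
    intro U hU; rw [(Finset.mem_filter.1 hU).2]
  rw [Finset.sum_congr rfl this, Finset.sum_const, nsmul_eq_mul]
  have h2 := count_good x0 n (𝒰.filter (fun U => (bdry U).card = n)) (by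
    intro U hU
    obtain ⟨h1, h2⟩ := Finset.mem_filter.1 hU
    exact ⟨(h U h1).1, (h U h1).2, h2⟩)
  gcongr

def shiftE (U : Finset Site) : (Site → ℤ) ≃ (Site → ℤ) :=
  Equiv.subRight (fun x => if x ∈ U then 1 else 0)

lemma shiftE_apply (U : Finset Site) (η : Site → ℤ) : shiftE U η = shift U η := rfl

lemma exp_q {β : ℝ} (hβ : 2 * Real.log 16 ≤ β) : Real.exp (-β/2) ≤ 1/16 := by
  calc Real.exp (-β/2) ≤ Real.exp (-Real.log 16) := Real.exp_le_exp.2 (by linarith)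
    _ = 1/16 := by rw [Real.exp_neg, Real.exp_log (by norm_num)]; norm_num

lemma log16_pos : 0 < 2 * Real.log 16 := by
  have := Real.log_pos (show (1:ℝ) < 16 by norm_num); linarith

lemma peierls {p β : ℝ} (hp : 2 < p) (hβ : 2 * Real.log 16 ≤ β) (Λ : Finset Site) (hΛ : RowConv Λ)
    (x0 : Site) (h : ℕ) (hh : 1 ≤ h) :
    pW p β Λ (fun η => η x0 = (h:ℤ)) ≤ Real.exp (-(epsP p / 4) * β * h) *
      pW p β Λ (fun η => η x0 = (h:ℤ) - 1) := by
  have hβ0 : 0 < β := lt_of_lt_of_le log16_pos hβ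
  let 𝒰 := Λ.powerset.filter (fun U => x0 ∈ U ∧ Good U)
  let q := Real.exp (-β/2)
  let C := Real.exp (-(epsP p / 4) * β * h)
  let f : (Site → ℤ) → ℝ := wtA p β Λ (fun η => η x0 = (h:ℤ) - 1)
  have hf : Summable f := wtA_summable hp hβ0 Λ _
  have hf0 : ∀ η, 0 ≤ f η := wtA_nonneg p β Λ _
  have hpt : ∀ η : Site → ℤ, wtA p β Λ (fun η => η x0 = (h:ℤ)) η ≤
      ∑ U ∈ 𝒰, C * q ^ (bdry U).card * f (shiftE U η) := by
    intro η
    have hnn : ∀ U ∈ 𝒰, 0 ≤ C * q ^ (bdry U).card * f (shiftE U η) := fun U _ => by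
      have := hf0 (shiftE U η)
      have : 0 < C := Real.exp_pos _
      have : 0 < q := Real.exp_pos _
      positivity
    by_cases h1 : η x0 = h
    swap
    · rw [wtA_neg h1]; exact Finset.sum_nonneg hnn
    by_cases h0 : ∀ x ∉ Λ, η x = 0
    swap
    · rw [wtA_pos h1, wt, if_neg h0]; exact Finset.sum_nonneg hnn
    obtain ⟨U, hU, hx, hG, hη, hs1, hs2⟩ := drop_config hp Λ hΛ η h0 x0 h hh h1
    have hmem : U ∈ 𝒰 := Finset.mem_filter.2 ⟨Finset.mem_powerset.2 hU, hx, hG⟩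
    refine le_trans ?_ (Finset.single_le_sum hnn hmem)
    have hd := pH_drop hp hU h0 hη
    rw [wtA_pos h1]
    simp only [f, shiftE_apply]
    rw [wtA_pos (by simp [shift, hx, h1]), wt, wt, if_pos h0, if_pos (shift_supp hU h0)]
    simp only [C, q]
    rw [← Real.exp_nat_mul, ← Real.exp_add, ← Real.exp_add]
    apply Real.exp_le_exp.2
    nlinarith
  have hsU : ∀ U ∈ 𝒰, Summable (fun η => C * q ^ (bdry U).card * f (shiftE U η)) := fun U _ =>
    ((shiftE U).summable_iff.2 hf).mul_left _
  rw [pW_eq, pW_eq]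
  calc ∑' η : Site → ℤ, wtA p β Λ (fun η => η x0 = (h:ℤ)) η
      ≤ ∑' η, ∑ U ∈ 𝒰, C * q ^ (bdry U).card * f (shiftE U η) :=
        (wtA_summable hp hβ0 Λ _).tsum_le_tsum hpt (summable_sum hsU)
    _ = ∑ U ∈ 𝒰, ∑' η, C * q ^ (bdry U).card * f (shiftE U η) := Summable.tsum_finsetSum hsU
    _ = ∑ U ∈ 𝒰, C * q ^ (bdry U).card * ∑' η, f η := by
        apply Finset.sum_congr rfl
        intro U _
        rw [tsum_mul_left, (shiftE U).tsum_eq]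
    _ = C * (∑ U ∈ 𝒰, q ^ (bdry U).card) * ∑' η, f η := by
        rw [Finset.mul_sum, Finset.sum_mul]
    _ ≤ C * 1 * ∑' η, f η := by
        have h1 : ∑ U ∈ 𝒰, q ^ (bdry U).card ≤ 1 :=
          contour_sum (Real.exp_pos _).le (exp_q hβ) x0 𝒰 (fun U hU => (Finset.mem_filter.1 hU).2)
        have h2 : 0 ≤ ∑' η, f η := tsum_nonneg hf0
        have h3 : 0 ≤ C := (Real.exp_pos _).le
        gcongr
    _ = C * ∑' η, f η := by rw [mul_one]

lemma pH_neg (p : ℝ) (η : Site → ℤ) : pH p (-η) = pH p η := by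
  rw [pH_def, pH_def]
  congr 2
  ext e
  unfold hterm
  have : |(-η) e.1 - (-η) e.2| = |η e.1 - η e.2| := by
    rw [← abs_neg]; congr 1; simp; ring
  rw [this]

lemma wt_neg (p β : ℝ) (Λ : Finset Site) (η : Site → ℤ) : wt p β Λ (-η) = wt p β Λ η := by
  unfold wt
  rw [pH_neg]
  simp

lemma pW_neg (p β : ℝ) (Λ : Finset Site) (x : Site) (k : ℤ) :
    pW p β Λ (fun η => η x = -k) = pW p β Λ (fun η => η x = k) := by
  rw [pW_eq, pW_eq, ← (Equiv.neg (Site → ℤ)).tsum_eq (wtA p β Λ (fun η => η x = -k))]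
  apply tsum_congr
  intro η
  rw [Equiv.neg_apply]
  by_cases h : η x = k
  · rw [wtA_pos (A := fun η : Site → ℤ => η x = k) h, wtA_pos (by simpa using h), wt_neg]
  · rw [wtA_neg (A := fun η : Site → ℤ => η x = k) h, wtA_neg (by simpa using h)]

def rr (p β : ℝ) : ℝ := Real.exp (-(epsP p / 4) * β)

lemma rr_pos (p β : ℝ) : 0 < rr p β := Real.exp_pos _

lemma rr_lt {p β : ℝ} (hp : 2 < p) (hβ : 0 < β) : rr p β < 1 := by
  have := epsP_pos hp
  unfold rr
  rw [Real.exp_lt_one_iff]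
  nlinarith

lemma decay_nat {p β : ℝ} (hp : 2 < p) (hβ : 2 * Real.log 16 ≤ β) (Λ : Finset Site) (hΛ : RowConv Λ)
    (x : Site) (n : ℕ) :
    pW p β Λ (fun η => η x = (n:ℤ)) ≤ rr p β ^ n * pW p β Λ (fun η => η x = 0) := by
  have hβ0 : 0 < β := lt_of_lt_of_le log16_pos hβ
  have hε := epsP_pos hp
  induction n with
  | zero => simp
  | succ n ih =>
    have h1 := peierls hp hβ Λ hΛ x (n+1) (by omega)
    have e1 : (((n+1:ℕ)):ℤ) - 1 = n := by push_cast; ring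
    rw [e1] at h1
    refine h1.trans ?_
    have h2 : Real.exp (-(epsP p / 4) * β * ((n+1:ℕ):ℝ)) ≤ rr p β := by
      unfold rr
      apply Real.exp_le_exp.2
      push_cast
      have : 0 ≤ epsP p / 4 * β * n := by positivity
      nlinarith
    calc _ ≤ rr p β * (rr p β ^ n * pW p β Λ (fun η => η x = 0)) := by
          apply mul_le_mul h2 ih (pW_nonneg _ _ _ _) (rr_pos _ _).le
      _ = _ := by rw [pow_succ]; ring

lemma decay_int {p β : ℝ} (hp : 2 < p) (hβ : 2 * Real.log 16 ≤ β) (Λ : Finset Site) (hΛ : RowConv Λ)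
    (x : Site) (k : ℤ) :
    pW p β Λ (fun η => η x = k) ≤ rr p β ^ k.natAbs * pW p β Λ (fun η => η x = 0) := by
  rcases Int.natAbs_eq k with h | h
  · have := decay_nat hp hβ Λ hΛ x k.natAbs
    rwa [← h] at this
  · have := decay_nat hp hβ Λ hΛ x k.natAbs
    rw [← pW_neg, ← h] at this
    exact this

lemma moment_sum {p β : ℝ} (hp : 2 < p) (hβ : 2 * Real.log 16 ≤ β) (Λ : Finset Site) (hΛ : RowConv Λ)
    (x : Site) (F : ℤ → ℝ) (hF : ∀ k, 0 ≤ F k) (hs : Summable (fun k : ℤ => F k * rr p β ^ k.natAbs))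
    (s : Finset (Site → ℤ)) :
    ∑ η ∈ s, F (η x) * wt p β Λ η ≤
      (∑' k : ℤ, F k * rr p β ^ k.natAbs) * pW p β Λ (fun η => η x = 0) := by
  have hβ0 : 0 < β := lt_of_lt_of_le log16_pos hβ
  have hr := rr_pos p β
  rw [← Finset.sum_fiberwise_of_maps_to (t := s.image (fun η => η x)) (g := fun η => η x)
    (fun η h => Finset.mem_image_of_mem _ h)]
  have h1 : ∀ k : ℤ, ∑ η ∈ s.filter (fun η => η x = k), F (η x) * wt p β Λ η ≤
      F k * pW p β Λ (fun η => η x = k) := by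
    intro k
    have : ∀ η ∈ s.filter (fun η => η x = k), F (η x) * wt p β Λ η =
        F k * wtA p β Λ (fun η => η x = k) η := by
      intro η hη
      have := (Finset.mem_filter.1 hη).2
      rw [wtA_pos this, this]
    rw [Finset.sum_congr rfl this, ← Finset.mul_sum, pW_eq]
    apply mul_le_mul_of_nonneg_left _ (hF k)
    exact (wtA_summable hp hβ0 Λ _).sum_le_tsum _ (fun η _ => wtA_nonneg _ _ _ _ _)
  calc _ ≤ ∑ k ∈ s.image (fun η => η x), F k * pW p β Λ (fun η => η x = k) :=
        Finset.sum_le_sum fun k _ => h1 k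
    _ ≤ ∑ k ∈ s.image (fun η => η x), (F k * rr p β ^ k.natAbs) * pW p β Λ (fun η => η x = 0) := by
        apply Finset.sum_le_sum
        intro k _
        rw [mul_assoc]
        exact mul_le_mul_of_nonneg_left (decay_int hp hβ Λ hΛ x k) (hF k)
    _ = (∑ k ∈ s.image (fun η => η x), (F k * rr p β ^ k.natAbs)) * pW p β Λ (fun η => η x = 0) := by
        rw [Finset.sum_mul]
    _ ≤ _ := by
        apply mul_le_mul_of_nonneg_right _ (pW_nonneg _ _ _ _)
        exact hs.sum_le_tsum _ (fun k _ => mul_nonneg (hF k) (by positivity))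

lemma moment {p β : ℝ} (hp : 2 < p) (hβ : 2 * Real.log 16 ≤ β) (Λ : Finset Site) (hΛ : RowConv Λ)
    (x : Site) (F : ℤ → ℝ) (hF : ∀ k, 0 ≤ F k) (hs : Summable (fun k : ℤ => F k * rr p β ^ k.natAbs)) :
    Summable (fun η : Site → ℤ => F (η x) * wt p β Λ η) ∧
    ∑' η : Site → ℤ, F (η x) * wt p β Λ η ≤
      (∑' k : ℤ, F k * rr p β ^ k.natAbs) * pW p β Λ (fun η => η x = 0) := by
  have h := moment_sum hp hβ Λ hΛ x F hF hs
  have h0 : ∀ η : Site → ℤ, 0 ≤ F (η x) * wt p β Λ η := fun η => mul_nonneg (hF _) (wt_nonneg _ _ _ _)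
  exact ⟨summable_of_sum_le h0 h, Real.tsum_le_of_sum_le h0 h⟩

lemma summ_one {r : ℝ} (h0 : 0 < r) (h1 : r < 1) : Summable (fun k : ℤ => (1:ℝ) * r ^ k.natAbs) := by
  apply Summable.of_nat_of_neg <;> simpa using summable_geometric_of_lt_one h0.le h1

lemma summ_p {r : ℝ} (h0 : 0 < r) (h1 : r < 1) (p : ℝ) :
    Summable (fun k : ℤ => ((|k| : ℤ):ℝ) ^ p * r ^ k.natAbs) := by
  have key : Summable (fun n : ℕ => (n:ℝ)^p * r ^ n) := by
    have hg := summable_pow_mul_geometric_of_norm_lt_one (R := ℝ) (⌈p⌉₊) (r := r)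
      (by rw [Real.norm_eq_abs, abs_of_pos h0]; exact h1)
    rw [← summable_nat_add_iff 1] at hg ⊢
    apply hg.of_nonneg_of_le
    · intro n; positivity
    · intro n
      gcongr
      rw [← Real.rpow_natCast]
      apply Real.rpow_le_rpow_of_exponent_le
      · push_cast; linarith [(Nat.cast_nonneg n : (0:ℝ) ≤ n)]
      · exact Nat.le_ceil p
  apply Summable.of_nat_of_neg <;> simpa using key

def C0 (p β : ℝ) : ℝ := ∑' k : ℤ, (1:ℝ) * rr p β ^ k.natAbs
def MM (p β : ℝ) : ℝ := ∑' k : ℤ, ((|k| : ℤ):ℝ) ^ p * rr p β ^ k.natAbs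

lemma C0_ge {p β : ℝ} (hp : 2 < p) (hβ : 0 < β) : 1 ≤ C0 p β := by
  have h := (summ_one (rr_pos p β) (rr_lt hp hβ)).le_tsum 0 (fun k _ => by
    have := rr_pos p β; positivity)
  simpa [C0] using h

lemma MM_nonneg (p β : ℝ) : 0 ≤ MM p β := by
  apply tsum_nonneg
  intro k
  have := rr_pos p β
  have : (0:ℝ) ≤ ((|k| : ℤ):ℝ) := by exact_mod_cast abs_nonneg k
  positivity

lemma wtA_true (p β : ℝ) (Λ : Finset Site) : wtA p β Λ (fun _ => True) = wt p β Λ := by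
  ext η; exact wtA_pos trivial

lemma W_le_zero {p β : ℝ} (hp : 2 < p) (hβ : 2 * Real.log 16 ≤ β) (Λ : Finset Site) (hΛ : RowConv Λ)
    (x : Site) : pW p β Λ (fun _ => True) ≤ C0 p β * pW p β Λ (fun η => η x = 0) := by
  have hβ0 : 0 < β := lt_of_lt_of_le log16_pos hβ
  have h := (moment hp hβ Λ hΛ x (fun _ => 1) (fun _ => zero_le_one)
    (summ_one (rr_pos p β) (rr_lt hp hβ0))).2
  simp only [one_mul] at h
  rw [pW_eq, wtA_true]
  simpa [C0] using h

lemma moment_p {p β : ℝ} (hp : 2 < p) (hβ : 2 * Real.log 16 ≤ β) (Λ : Finset Site) (hΛ : RowConv Λ)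
    (x : Site) :
    Summable (fun η : Site → ℤ => ((|η x| : ℤ):ℝ) ^ p * wt p β Λ η) ∧
    ∑' η : Site → ℤ, ((|η x| : ℤ):ℝ) ^ p * wt p β Λ η ≤ MM p β * pW p β Λ (fun _ => True) := by
  have hβ0 : 0 < β := lt_of_lt_of_le log16_pos hβ
  have h := moment hp hβ Λ hΛ x (fun k => ((|k| : ℤ):ℝ) ^ p)
    (fun k => Real.rpow_nonneg (by exact_mod_cast abs_nonneg k) _)
    (summ_p (rr_pos p β) (rr_lt hp hβ0) p)
  refine ⟨h.1, h.2.trans ?_⟩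
  apply mul_le_mul_of_nonneg_left _ (MM_nonneg p β)
  exact pW_mono hp hβ0 Λ (fun _ _ => trivial)

def psi (h : ℕ) (x : Site) : ℤ := max ((h:ℤ) - |x.1| - |x.2|) 0

def Fset (h : ℕ) : Finset (Site × Site) :=
  ((Finset.Icc (-(h:ℤ)) h) ×ˢ (Finset.Icc (-(h:ℤ)) h)).biUnion (fun x => (nbrs x).image (Prod.mk x))

lemma Fset_card (h : ℕ) (hh : 1 ≤ h) : ((Fset h).card : ℝ) ≤ 36 * (h:ℝ)^2 := by
  have h1 : (Fset h).card ≤ ((Finset.Icc (-(h:ℤ)) h) ×ˢ (Finset.Icc (-(h:ℤ)) h)).card * 4 := by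
    apply Finset.card_biUnion_le_card_mul
    intro x _
    exact Finset.card_image_le.trans Finset.card_le_four
  rw [Finset.card_product, Int.card_Icc] at h1
  have e : ((h:ℤ) + 1 - -(h:ℤ)).toNat = 2*h+1 := by omega
  rw [e] at h1
  have h2 : ((Fset h).card : ℝ) ≤ (2*h+1)*(2*h+1)*4 := by exact_mod_cast h1
  have h3 : (1:ℝ) ≤ h := by exact_mod_cast hh
  nlinarith

lemma psi_diff (h : ℕ) {e : Site × Site} (ha : adjP e.1 e.2) : |psi h e.1 - psi h e.2| ≤ 1 := by
  obtain ⟨⟨a,b⟩,⟨c,d⟩⟩ := e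
  simp only [adjP, psi, abs_eq_max_neg] at *
  omega

lemma psi_same (h : ℕ) {e : Site × Site} (ha : adjP e.1 e.2) (he : e ∉ Fset h) : psi h e.1 = psi h e.2 := by
  have : ¬ (|e.1.1| ≤ h ∧ |e.1.2| ≤ h) := by
    rintro ⟨h1, h2⟩
    apply he
    rw [abs_le] at h1 h2
    refine Finset.mem_biUnion.2 ⟨e.1, Finset.mem_product.2 ⟨Finset.mem_Icc.2 h1, Finset.mem_Icc.2 h2⟩, ?_⟩
    exact Finset.mem_image.2 ⟨e.2, adjP_iff.1 ha, rfl⟩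
  obtain ⟨⟨a,b⟩,⟨c,d⟩⟩ := e
  simp only [adjP, psi, abs_eq_max_neg] at *
  omega

lemma psi_supp {h L : ℕ} (hL : h ≤ L) {x : Site} (hx : x ∉ ball L) : psi h x = 0 := by
  by_contra hne
  apply hx
  obtain ⟨a,b⟩ := x
  have h1 : |a| + |b| ≤ L := by
    simp only [psi] at hne; omega
  simp only [ball, Int.ceil_natCast, Finset.mem_filter, Finset.mem_product, Finset.mem_Icc]
  have h1' := h1
  simp only [abs_eq_max_neg] at h1'
  refine ⟨⟨⟨by omega, by omega⟩, by omega, by omega⟩, ?_⟩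
  have h2 : |(a:ℝ)| + |(b:ℝ)| ≤ L := by exact_mod_cast h1
  have := abs_nonneg (a:ℝ)
  have := abs_nonneg (b:ℝ)
  have := sq_abs (a:ℝ)
  have := sq_abs (b:ℝ)
  nlinarith

def GG (p : ℝ) (ξ : Site → ℤ) (e : Site × Site) : ℝ :=
  3^p * (1 + ((|ξ e.1| : ℤ):ℝ)^p + ((|ξ e.2| : ℤ):ℝ)^p)

lemma abs_cast_nonneg (k : ℤ) : (0:ℝ) ≤ ((|k| : ℤ):ℝ) := by exact_mod_cast abs_nonneg k

lemma GG_nonneg (p : ℝ) (ξ : Site → ℤ) (e : Site × Site) : 0 ≤ GG p ξ e := by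
  have := abs_cast_nonneg (ξ e.1)
  have := abs_cast_nonneg (ξ e.2)
  unfold GG; positivity

lemma rpow_three {p : ℝ} (hp : 2 < p) {a b d : ℝ} (ha : 0 ≤ a) (hb : 0 ≤ b) (hd0 : 0 ≤ d) (hd : d ≤ 1 + a + b) :
    d ^ p ≤ 3^p * (1 + a^p + b^p) := by
  have ha' : 0 ≤ a^p := Real.rpow_nonneg ha p
  have hb' : 0 ≤ b^p := Real.rpow_nonneg hb p
  have key : ∀ m : ℝ, 0 ≤ m → d ≤ 3 * m → m ^ p ≤ 1 + a^p + b^p → d^p ≤ 3^p * (1 + a^p + b^p) := by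
    intro m hm h1 h2
    calc d^p ≤ (3*m)^p := Real.rpow_le_rpow hd0 h1 (by linarith)
      _ = 3^p * m^p := Real.mul_rpow (by norm_num) hm
      _ ≤ _ := by gcongr
  by_cases h1 : a ≤ 1 ∧ b ≤ 1
  · apply key 1 zero_le_one (by linarith)
    rw [Real.one_rpow]; linarith
  · by_cases h2 : a ≤ b
    · apply key b hb _ (by linarith)
      by_cases h3 : a ≤ 1
      · have : 1 < b := by by_contra h4; exact h1 ⟨h3, by linarith⟩
        linarith
      · linarith
    · apply key a ha _ (by linarith)
      have : 1 < a := by by_contra h4; exact h1 ⟨by linarith, by linarith⟩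
      linarith

lemma hterm_psi {p : ℝ} (hp : 2 < p) (h : ℕ) (ξ : Site → ℤ) (e : Site × Site) :
    hterm p (ξ + psi h) e ≤ hterm p ξ e + if e ∈ Fset h then GG p ξ e else 0 := by
  by_cases ha : adjP e.1 e.2
  swap
  · simp only [hterm, if_neg ha]
    split_ifs
    · linarith [GG_nonneg p ξ e]
    · linarith
  by_cases he : e ∈ Fset h
  · rw [if_pos he]
    have h1 := hterm_nonneg p ξ e
    have h2 : hterm p (ξ + psi h) e ≤ GG p ξ e := by
      rw [hterm, if_pos ha, GG]
      apply rpow_three hp (abs_cast_nonneg _) (abs_cast_nonneg _) (abs_cast_nonneg _)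
      have h3 := psi_diff h ha
      have h4 : |(ξ + psi h) e.1 - (ξ + psi h) e.2| ≤ 1 + |ξ e.1| + |ξ e.2| := by
        simp only [Pi.add_apply, abs_eq_max_neg] at h3 ⊢
        omega
      exact_mod_cast h4
    linarith
  · rw [if_neg he, add_zero]
    have := psi_same h ha he
    simp only [hterm, if_pos ha, Pi.add_apply, this]
    simp

def YY (p : ℝ) (h : ℕ) (ξ : Site → ℤ) : ℝ := ∑ e ∈ Fset h, GG p ξ e

lemma YY_nonneg (p : ℝ) (h : ℕ) (ξ : Site → ℤ) : 0 ≤ YY p h ξ :=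
  Finset.sum_nonneg fun e _ => GG_nonneg p ξ e

lemma pH_psi {p : ℝ} (hp : 2 < p) {h : ℕ} {Λ : Finset Site} (hψ : ∀ x ∉ Λ, psi h x = 0) {ξ : Site → ℤ}
    (h0 : ∀ x ∉ Λ, ξ x = 0) : pH p (ξ + psi h) ≤ pH p ξ + YY p h ξ := by
  have h0' : ∀ x ∉ Λ, (ξ + psi h) x = 0 := fun x hx => by simp [h0 x hx, hψ x hx]
  rw [pH_def, pH_def]
  have hs1 := hterm_summable hp h0
  have hs2 := hterm_summable hp h0'
  have hs3 : HasSum (fun e => if e ∈ Fset h then GG p ξ e else 0) (YY p h ξ) := by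
    have e1 : YY p h ξ = ∑ e ∈ Fset h, (if e ∈ Fset h then GG p ξ e else 0) := by
      unfold YY
      apply Finset.sum_congr rfl
      intro e he
      rw [if_pos he]
    rw [e1]
    exact hasSum_sum_of_ne_finset_zero (fun e he => if_neg he)
  have h1 := hs2.tsum_le_tsum (hterm_psi hp h ξ) (hs1.add hs3.summable)
  rw [hs1.tsum_add hs3.summable, hs3.tsum_eq] at h1
  have := YY_nonneg p h ξ
  linarith

def DD (p β : ℝ) : ℝ := 36 * (3^p * (1 + 2 * MM p β))

lemma YY_moment {p β : ℝ} (hp : 2 < p) (hβ : 2 * Real.log 16 ≤ β) (Λ : Finset Site) (hΛ : RowConv Λ)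
    (h : ℕ) (hh : 1 ≤ h) :
    Summable (fun η : Site → ℤ => YY p h η * wt p β Λ η) ∧
    ∑' η : Site → ℤ, YY p h η * wt p β Λ η ≤ DD p β * (h:ℝ)^2 * pW p β Λ (fun _ => True) := by
  have hβ0 : 0 < β := lt_of_lt_of_le log16_pos hβ
  have hW : ∑' η, wt p β Λ η = pW p β Λ (fun _ => True) := by rw [pW_eq, wtA_true]
  have hone : ∀ e : Site × Site, HasSum (fun η : Site → ℤ => GG p η e * wt p β Λ η)
     (3^p * (pW p β Λ (fun _ => True) + ∑' η : Site → ℤ, ((|η e.1| : ℤ):ℝ)^p * wt p β Λ η +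
      ∑' η : Site → ℤ, ((|η e.2| : ℤ):ℝ)^p * wt p β Λ η)) := by
    intro e
    have a0 := (wt_summable hp hβ0 Λ).hasSum
    rw [hW] at a0
    have a1 := (moment_p hp hβ Λ hΛ e.1).1.hasSum
    have a2 := (moment_p hp hβ Λ hΛ e.2).1.hasSum
    have := ((a0.add a1).add a2).mul_left (3^p)
    refine Eq.mp ?_ this
    congr 1
    ext η
    unfold GG; ring
  have hle : ∀ e : Site × Site, 3^p * (pW p β Λ (fun _ => True) + ∑' η : Site → ℤ, ((|η e.1| : ℤ):ℝ)^p * wt p β Λ η +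
      ∑' η : Site → ℤ, ((|η e.2| : ℤ):ℝ)^p * wt p β Λ η) ≤ 3^p * (1 + 2 * MM p β) * pW p β Λ (fun _ => True) := by
    intro e
    have a1 := (moment_p hp hβ Λ hΛ e.1).2
    have a2 := (moment_p hp hβ Λ hΛ e.2).2
    rw [mul_assoc]
    apply mul_le_mul_of_nonneg_left _ (by positivity)
    linarith
  have hsum := hasSum_sum (s := Fset h) (fun e _ => hone e)
  have heq : (fun η : Site → ℤ => YY p h η * wt p β Λ η) =
      fun η => ∑ e ∈ Fset h, GG p η e * wt p β Λ η := by
    ext η; rw [YY, Finset.sum_mul]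
  rw [heq]
  refine ⟨hsum.summable, ?_⟩
  rw [hsum.tsum_eq]
  refine (Finset.sum_le_sum (fun e _ => hle e)).trans ?_
  rw [Finset.sum_const, nsmul_eq_mul]
  have h1 := Fset_card h hh
  have h2 := MM_nonneg p β
  have h3 := pW_nonneg p β Λ (fun _ => True)
  calc ((Fset h).card : ℝ) * (3^p * (1 + 2 * MM p β) * pW p β Λ (fun _ => True))
      ≤ (36 * (h:ℝ)^2) * (3^p * (1 + 2 * MM p β) * pW p β Λ (fun _ => True)) := by gcongr
    _ = _ := by unfold DD; ring

lemma DD_pos (p β : ℝ) : 0 < DD p β := by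
  have := MM_nonneg p β
  unfold DD; positivity

lemma wt_psi {p β : ℝ} (hp : 2 < p) (hβ : 0 < β) {h : ℕ} {Λ : Finset Site} (hψ : ∀ x ∉ Λ, psi h x = 0)
    (ξ : Site → ℤ) (T : ℝ) (hT : YY p h ξ ≤ T) :
    Real.exp (-β * T) * wt p β Λ ξ ≤ wt p β Λ (ξ + psi h) := by
  by_cases h0 : ∀ x ∉ Λ, ξ x = 0
  · have h0' : ∀ x ∉ Λ, (ξ + psi h) x = 0 := fun x hx => by simp [h0 x hx, hψ x hx]
    rw [wt, wt, if_pos h0, if_pos h0', ← Real.exp_add]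
    apply Real.exp_le_exp.2
    have := pH_psi hp hψ h0
    nlinarith
  · rw [wt, if_neg h0, mul_zero]; exact wt_nonneg _ _ _ _

lemma lower {p β : ℝ} (hp : 2 < p) (hβ : 2 * Real.log 16 ≤ β) (h L : ℕ) (hh : 1 ≤ h) (hL : h ≤ L) :
    Real.exp (-β * (2 * C0 p β * DD p β * (h:ℝ)^2)) * (pW p β (ball L) (fun _ => True) / (2 * C0 p β)) ≤
      pW p β (ball L) (fun η => η (0,0) = (h:ℤ)) := by
  have hβ0 : 0 < β := lt_of_lt_of_le log16_pos hβ
  set Λ := ball L with hΛdef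
  have hΛ : RowConv Λ := ball_rowConv L
  have hψ : ∀ x ∉ Λ, psi h x = 0 := fun x hx => psi_supp hL hx
  have hC := C0_ge hp hβ0
  have hD := DD_pos p β
  have hh' : (1:ℝ) ≤ h := by exact_mod_cast hh
  set T := 2 * C0 p β * DD p β * (h:ℝ)^2 with hT
  have hTpos : 0 < T := by positivity
  set W := pW p β Λ (fun _ => True) with hW
  let B : (Site → ℤ) → Prop := fun ξ => ξ (0,0) = 0 ∧ YY p h ξ ≤ T
  obtain ⟨hY1, hY2⟩ := YY_moment hp hβ Λ hΛ h hh
  -- Markov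
  have hM : pW p β Λ (fun ξ => ξ (0,0) = 0) ≤ pW p β Λ B + (1/T) * ∑' η : Site → ℤ, YY p h η * wt p β Λ η := by
    rw [pW_eq, pW_eq, ← tsum_mul_left, ← (wtA_summable hp hβ0 Λ B).tsum_add (hY1.mul_left _)]
    apply (wtA_summable hp hβ0 Λ _).tsum_le_tsum _ ((wtA_summable hp hβ0 Λ B).add (hY1.mul_left _))
    intro ξ
    have hw := wt_nonneg p β Λ ξ
    have hy := YY_nonneg p h ξ
    by_cases h1 : ξ (0,0) = 0
    swap
    · rw [wtA_neg h1]
      have := wtA_nonneg p β Λ B ξ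
      positivity
    rw [wtA_pos h1]
    by_cases h2 : YY p h ξ ≤ T
    · rw [wtA_pos (A := B) ⟨h1, h2⟩]
      have : 0 ≤ 1/T * (YY p h ξ * wt p β Λ ξ) := by positivity
      linarith
    · push Not at h2
      have := wtA_nonneg p β Λ B ξ
      have h3 : 1 ≤ 1/T * YY p h ξ := by
        rw [one_div, inv_mul_eq_div, le_div_iff₀ hTpos]; linarith
      have h4 : wt p β Λ ξ ≤ 1/T * YY p h ξ * wt p β Λ ξ := le_mul_of_one_le_left hw h3
      rw [← mul_assoc]
      linarith
  have hB : W / (2 * C0 p β) ≤ pW p β Λ B := by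
    have h1 := W_le_zero hp hβ Λ hΛ (0,0)
    have h2 : (1/T) * ∑' η : Site → ℤ, YY p h η * wt p β Λ η ≤ W / (2 * C0 p β) := by
      calc _ ≤ (1/T) * (DD p β * (h:ℝ)^2 * W) := by gcongr
        _ = _ := by rw [hT]; field_simp
    have h3 : W / C0 p β ≤ pW p β Λ (fun ξ => ξ (0,0) = 0) := by
      rw [div_le_iff₀ (by linarith)]; linarith
    have h4 : W / C0 p β = W / (2 * C0 p β) + W / (2 * C0 p β) := by field_simp; norm_num
    linarith
  refine (mul_le_mul_of_nonneg_left hB (Real.exp_pos _).le).trans ?_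
  rw [pW_eq, pW_eq, ← tsum_mul_left, ← (Equiv.addRight (psi h)).tsum_eq (wtA p β Λ (fun η => η (0,0) = (h:ℤ)))]
  apply ((wtA_summable hp hβ0 Λ B).mul_left _).tsum_le_tsum
  · intro ξ
    rw [Equiv.coe_addRight]
    by_cases h1 : B ξ
    · rw [wtA_pos h1, wtA_pos]
      · exact wt_psi hp hβ0 hψ ξ T h1.2
      · have := h1.1
        simp [this, psi]
    · rw [wtA_neg h1, mul_zero]; exact wtA_nonneg _ _ _ _ _
  · exact (Equiv.addRight (psi h)).summable_iff.2 (wtA_summable hp hβ0 Λ _)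

lemma W_pos {p β : ℝ} (hp : 2 < p) (hβ : 0 < β) (Λ : Finset Site) : 0 < pW p β Λ (fun _ => True) := by
  rw [pW_eq, wtA_true]
  apply (wt_summable hp hβ Λ).tsum_pos (wt_nonneg p β Λ) 0
  have h0 : ∀ x ∉ Λ, (0 : Site → ℤ) x = 0 := fun _ _ => rfl
  rw [wt, if_pos h0]
  exact Real.exp_pos _

lemma upper {p β : ℝ} (hp : 2 < p) (hβ : 2 * Real.log 16 ≤ β) (Λ : Finset Site) (hΛ : RowConv Λ)
    (x : Site) (n : ℕ) :
    pW p β Λ (fun η => η x = (n:ℤ)) ≤ Real.exp (-(epsP p / 8) * β * (n:ℝ)^2) * pW p β Λ (fun _ => True) := by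
  have hβ0 : 0 < β := lt_of_lt_of_le log16_pos hβ
  have hε := epsP_pos hp
  induction n with
  | zero =>
    simp only [Nat.cast_zero]
    rw [zero_pow two_ne_zero, mul_zero, Real.exp_zero, one_mul]
    exact pW_mono hp hβ0 Λ (fun _ _ => trivial)
  | succ n ih =>
    have h1 := peierls hp hβ Λ hΛ x (n+1) (by omega)
    have e1 : (((n+1:ℕ)):ℤ) - 1 = n := by push_cast; ring
    rw [e1] at h1
    refine h1.trans ((mul_le_mul_of_nonneg_left ih (Real.exp_pos _).le).trans ?_)
    rw [← mul_assoc, ← Real.exp_add]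
    apply mul_le_mul_of_nonneg_right _ (pW_nonneg _ _ _ _)
    apply Real.exp_le_exp.2
    push_cast
    have : 0 < epsP p * β := by positivity
    nlinarith

/-- **Lemma 4.6.** For `p > 2`: `e^{−c₁βh²} ≤ π^{(p)}(η_0 = h) ≤ e^{−c₂βh²}` and
`π^{(p)}(η_0 = h) ≤ e^{−c₃βh} π^{(p)}(η_0 = h−1)`. -/
theorem pSOS_rate_p_gt_two (p : ℝ) (hp : 2 < p) :
    ∃ β₀ > (0 : ℝ), ∀ β ≥ β₀, ∃ c₁ > (0 : ℝ), ∃ c₂ > (0 : ℝ), ∃ c₃ > (0 : ℝ),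
      ∀ h : ℕ, 1 ≤ h → ∃ L₀ : ℕ, ∀ L : ℕ, L₀ ≤ L →
        (Real.exp (-c₁ * β * (h : ℝ) ^ 2) ≤
            pProb p β (ball L) (fun η => η (0, 0) = (h : ℤ)) ∧
          pProb p β (ball L) (fun η => η (0, 0) = (h : ℤ)) ≤
            Real.exp (-c₂ * β * (h : ℝ) ^ 2)) ∧
        pProb p β (ball L) (fun η => η (0, 0) = (h : ℤ)) ≤
          Real.exp (-c₃ * β * (h : ℝ)) *
            pProb p β (ball L) (fun η => η (0, 0) = (h : ℤ) - 1) := by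
  have hε := epsP_pos hp
  refine ⟨2 * Real.log 16, log16_pos, fun β hβ => ?_⟩
  have hβ0 : 0 < β := lt_of_lt_of_le log16_pos hβ
  have hC := C0_ge hp hβ0
  have hD := DD_pos p β
  have hlog : 0 ≤ Real.log (2 * C0 p β) := Real.log_nonneg (by linarith)
  refine ⟨2 * C0 p β * DD p β + Real.log (2 * C0 p β) / β, by positivity,
    epsP p / 8, by positivity, epsP p / 4, by positivity, fun h hh => ⟨h, fun L hL => ?_⟩⟩
  have hh' : (1:ℝ) ≤ h := by exact_mod_cast hh
  have hW := W_pos hp hβ0 (ball L)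
  unfold pProb
  refine ⟨⟨?_, ?_⟩, ?_⟩
  · rw [le_div_iff₀ hW]
    refine le_trans ?_ (lower hp hβ h L hh hL)
    rw [div_eq_mul_inv (pW p β (ball L) _), mul_comm (pW p β (ball L) _) (_⁻¹), ← mul_assoc]
    apply mul_le_mul_of_nonneg_right _ hW.le
    have e1 : (2 * C0 p β)⁻¹ = Real.exp (-Real.log (2 * C0 p β)) := by
      rw [Real.exp_neg, Real.exp_log (by linarith)]
    rw [e1, ← Real.exp_add]
    apply Real.exp_le_exp.2
    have e2 : -(2 * C0 p β * DD p β + Real.log (2 * C0 p β) / β) * β * (h:ℝ)^2 =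
        -β * (2 * C0 p β * DD p β * (h:ℝ)^2) - Real.log (2 * C0 p β) * (h:ℝ)^2 := by
      field_simp; ring
    rw [e2]
    have : (1:ℝ) ≤ (h:ℝ)^2 := by nlinarith
    nlinarith
  · rw [div_le_iff₀ hW]
    exact upper hp hβ (ball L) (ball_rowConv L) (0,0) h
  · rw [← mul_div_assoc]
    apply div_le_div_of_nonneg_right _ hW.le
    exact peierls hp hβ (ball L) (ball_rowConv L) (0,0) h hh
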